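/- arXiv:alg-geom/9706011 — 2 statements merged into one kernel-verified Lean document; each statement's English description precedes it below -/
import Mathlib

section
/- Let G be a connected solvable linear algebraic group over a field F of characteristic 0, with unipotent radical U and maximal torus T, so that G is the semidirect product of T and U. If T acts trivially by conjugation on the abelianization U/[U,U], then G is isomorphic to the direct product T × U; in particular G is nilpotent. -/
open Matrix

/-- A subgroup of `GL n F` is algebraic if it is the zero locus, inside
`GL n F`, of a set of polynomials in the matrix entries. -/
def IsAlgebraicSubgroup (F : Type) [Field F] (n : ℕ)
    (G : Subgroup (GL (Fin n) F)) : Prop :=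
  ∃ S : Set (MvPolynomial (Fin n × Fin n) F),
    ∀ g : GL (Fin n) F, g ∈ G ↔ ∀ p ∈ S,
      MvPolynomial.eval (fun ij => (g : Matrix (Fin n) (Fin n) F) ij.1 ij.2) p = 0

/-- An element of `GL n F` is unipotent if `g - 1` is nilpotent. -/
def IsUnipotentElt (F : Type) [Field F] (n : ℕ) (g : GL (Fin n) F) : Prop :=
  IsNilpotent ((g : Matrix (Fin n) (Fin n) F) - 1)

/-- An element of `GL n F` is semisimple if the corresponding endomorphism of
`Fⁿ` is a semisimple linear map. -/
def IsSemisimpleElt (F : Type) [Field F] (n : ℕ) (g : GL (Fin n) F) : Prop :=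
  Module.End.IsSemisimple (Matrix.toLin' (g : Matrix (Fin n) (Fin n) F))

/-- An algebraic subgroup is connected if it has no proper algebraic subgroup
of finite index. -/
def IsConnectedAlgSubgroup (F : Type) [Field F] (n : ℕ)
    (G : Subgroup (GL (Fin n) F)) : Prop :=
  IsAlgebraicSubgroup F n G ∧
  ∀ H : Subgroup (GL (Fin n) F), IsAlgebraicSubgroup F n H → H ≤ G →
    (H.subgroupOf G).FiniteIndex → H = G

section UnipotentGroups

open Module
open scoped commutatorElement

section TracePowers

variable {F V : Type*} [Field F] [CharZero F] [AddCommGroup V] [Module F V] [FiniteDimensional F V]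

open Polynomial in
/-- In characteristic zero an endomorphism whose positive powers all have trace zero is
nilpotent. -/
theorem isNilpotent_of_trace_pow_eq_zero (x : End F V)
    (hx : ∀ k : ℕ, LinearMap.trace F V (x ^ (k + 1)) = 0) : IsNilpotent x := by
  obtain ⟨q, hq, hq0⟩ := exists_eq_pow_rootMultiplicity_mul_and_not_dvd (minpoly F x)
    (minpoly.ne_zero (Algebra.IsIntegral.isIntegral x)) 0
  rw [map_zero, sub_zero] at hq hq0
  set m := (minpoly F x).rootMultiplicity 0
  have hcop : IsCoprime (X ^ (m + 1) : F[X]) q :=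
    IsCoprime.pow_left ((irreducible_X.coprime_iff_not_dvd).2 hq0)
  obtain ⟨a, b, hab⟩ := hcop
  have hzero : aeval x (X ^ m * q) = 0 := by rw [← hq, minpoly.aeval]
  have hidem : IsIdempotentElem (aeval x (a * X ^ (m + 1))) := by
    have h : (a * X ^ (m + 1)) * (a * X ^ (m + 1)) =
        a * X ^ (m + 1) - (X ^ m * q) * (a * b * X) := by
      linear_combination (a * X ^ (m + 1)) * hab
    rw [IsIdempotentElem, ← map_mul, h, map_sub, map_mul (aeval x) (X ^ m * q), hzero, zero_mul, sub_zero]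
  have htrace : LinearMap.trace F V (aeval x (a * X ^ (m + 1))) = 0 := by
    rw [map_mul, map_pow, aeval_X, aeval_eq_sum_range, Finset.sum_mul, map_sum]
    refine Finset.sum_eq_zero fun i _ => ?_
    rw [smul_mul_assoc, ← pow_add, map_smul, ← add_assoc, hx, smul_zero]
  have he := LinearMap.IsIdempotentElem.eq_zero_of_trace_eq_zero hidem htrace
  refine ⟨m, ?_⟩
  have h : (X ^ m : F[X]) = X ^ m * (a * X ^ (m + 1)) + (X ^ m * q) * b := by
    linear_combination -X ^ m * hab
  have h' := congrArg (aeval x) h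
  rwa [map_add, map_mul, map_mul (aeval x) (X ^ m * q), hzero, he, mul_zero, zero_mul, add_zero,
    map_pow, aeval_X] at h'

end TracePowers

section Nil

variable {F V : Type*} [Field F] [AddCommGroup V] [Module F V] [FiniteDimensional F V]

attribute [local instance] LieRing.ofAssociativeRing

/-- A multiplicatively closed space of nilpotent endomorphisms is nilpotent. -/
theorem exists_submodule_pow_eq_bot (I : Submodule F (End F V)) (hmul : I * I ≤ I)
    (hnil : ∀ x ∈ I, IsNilpotent x) : ∃ N, I ^ N = ⊥ := by
  let L : LieSubalgebra F (End F V) :=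
    { I with
      lie_mem' := fun {x y} hx hy => I.sub_mem (hmul (Submodule.mul_mem_mul hx hy))
        (hmul (Submodule.mul_mem_mul hy hx)) }
  have hL : LieModule.IsNilpotent L V :=
    (LieModule.isNilpotent_iff_forall' (R := F)).2 fun x => hnil x.1 x.2
  obtain ⟨N, hN⟩ := (LieModule.isNilpotent_iff F L V).1 hL
  have key : ∀ k, ∀ x ∈ I ^ k, ∀ v : V, x v ∈ LieModule.lowerCentralSeries F L V k := by
    intro k
    induction k with
    | zero => simp
    | succ k ih =>
      intro x hx v
      rw [pow_succ'] at hx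
      induction hx using Submodule.mul_induction_on' with
      | mem_mul_mem y hy z hz =>
        rw [LieModule.lowerCentralSeries_succ]
        exact LieSubmodule.lie_mem_lie (x := (⟨y, hy⟩ : L)) (LieSubmodule.mem_top _) (ih z hz v)
      | add y _ z _ hy hz => exact add_mem hy hz
  refine ⟨N, (Submodule.eq_bot_iff _).2 fun x hx => LinearMap.ext fun v => ?_⟩
  simpa [hN] using key N x hx v

end Nil

variable {F V Γ : Type*} [Field F] [AddCommGroup V] [Module F V] [Group Γ]

/-- The span of the operators `ρ u - 1` with `u ∈ U`. -/
def augmentationSpan (ρ : Γ →* End F V) (U : Subgroup Γ) : Submodule F (End F V) :=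
  Submodule.span F ((fun u => ρ u - 1) '' (U : Set Γ))

variable (ρ : Γ →* End F V) (U : Subgroup Γ)

theorem sub_one_mem_augmentationSpan {u : Γ} (hu : u ∈ U) :
    ρ u - 1 ∈ augmentationSpan ρ U :=
  Submodule.subset_span ⟨u, hu, rfl⟩

theorem augmentationSpan_mul_le :
    augmentationSpan ρ U * augmentationSpan ρ U ≤ augmentationSpan ρ U := by
  rw [augmentationSpan, Submodule.span_mul_span, Submodule.span_le]
  rintro _ ⟨_, ⟨u, hu, rfl⟩, _, ⟨v, hv, rfl⟩, rfl⟩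
  have h : (ρ u - 1) * (ρ v - 1) = (ρ (u * v) - 1) - (ρ u - 1) - (ρ v - 1) := by
    rw [map_mul]; noncomm_ring
  change (ρ u - 1) * (ρ v - 1) ∈ augmentationSpan ρ U
  rw [h]
  exact sub_mem (sub_mem (sub_one_mem_augmentationSpan ρ U (U.mul_mem hu hv))
    (sub_one_mem_augmentationSpan ρ U hu)) (sub_one_mem_augmentationSpan ρ U hv)

theorem augmentationSpan_pow_succ_le (k : ℕ) :
    augmentationSpan ρ U ^ (k + 2) ≤ augmentationSpan ρ U ^ (k + 1) := by
  rw [pow_succ, pow_succ, mul_assoc]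
  exact mul_le_mul_right (augmentationSpan_mul_le ρ U) _

theorem mul_mem_augmentationSpan_pow {k : ℕ} {x : End F V}
    (hx : x ∈ augmentationSpan ρ U ^ (k + 1)) {u : Γ} (hu : u ∈ U) :
    x * ρ u ∈ augmentationSpan ρ U ^ (k + 1) := by
  have h : x * ρ u = x * (ρ u - 1) + x := by noncomm_ring
  rw [h]
  refine add_mem (augmentationSpan_pow_succ_le ρ U k ?_) hx
  rw [pow_succ]
  exact Submodule.mul_mem_mul hx (sub_one_mem_augmentationSpan ρ U hu)

theorem map_mul_inv_cancel (g : Γ) : ρ g * ρ g⁻¹ = 1 := by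
  rw [← map_mul, mul_inv_cancel, map_one]

/-- The elements of `U` congruent to `1` modulo a power of the augmentation span. -/
def augmentationSubgroup (k : ℕ) : Subgroup Γ where
  carrier := {u | u ∈ U ∧ ρ u - 1 ∈ augmentationSpan ρ U ^ (k + 1)}
  one_mem' := ⟨U.one_mem, by simp⟩
  mul_mem' := by
    rintro u v ⟨hu, hu'⟩ ⟨hv, hv'⟩
    refine ⟨U.mul_mem hu hv, ?_⟩
    have h : ρ (u * v) - 1 = (ρ u - 1) * ρ v + (ρ v - 1) := by
      rw [map_mul]; noncomm_ring
    rw [h]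
    exact add_mem (mul_mem_augmentationSpan_pow ρ U hu' hv) hv'
  inv_mem' := by
    rintro u ⟨hu, hu'⟩
    refine ⟨U.inv_mem hu, ?_⟩
    have h : ρ u⁻¹ - 1 = -((ρ u - 1) * ρ u⁻¹) := by
      rw [sub_mul, map_mul_inv_cancel, one_mul, neg_sub]
    rw [h]
    exact neg_mem (mul_mem_augmentationSpan_pow ρ U hu' (U.inv_mem hu))

theorem commutator_mem_augmentationSubgroup {k : ℕ} {u v : Γ}
    (hu : u ∈ augmentationSubgroup ρ U k) (hv : v ∈ U) :
    ⁅u, v⁆ ∈ augmentationSubgroup ρ U (k + 1) := by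
  obtain ⟨hu, hu'⟩ := hu
  have hinv : u⁻¹ * v⁻¹ ∈ U := U.mul_mem (U.inv_mem hu) (U.inv_mem hv)
  refine ⟨?_, ?_⟩
  · rw [commutatorElement_def, mul_assoc]
    exact U.mul_mem (U.mul_mem hu hv) hinv
  have h1 : ⁅u, v⁆ = u * v * (u⁻¹ * v⁻¹) := by rw [commutatorElement_def, mul_assoc]
  have h2 : (1 : End F V) = ρ v * ρ u * ρ (u⁻¹ * v⁻¹) := by
    rw [← map_mul, ← map_mul, ← map_one ρ]; congr 1; group
  have h : ρ ⁅u, v⁆ - 1 =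
      ((ρ u - 1) * (ρ v - 1) - (ρ v - 1) * (ρ u - 1)) * ρ (u⁻¹ * v⁻¹) := by
    have h3 : (ρ u - 1) * (ρ v - 1) - (ρ v - 1) * (ρ u - 1) = ρ u * ρ v - ρ v * ρ u := by
      noncomm_ring
    rw [h3, h1, map_mul, map_mul, sub_mul, ← h2]
  rw [h]
  refine mul_mem_augmentationSpan_pow ρ U (sub_mem ?_ ?_) hinv
  · rw [pow_succ]
    exact Submodule.mul_mem_mul hu' (sub_one_mem_augmentationSpan ρ U hv)
  · rw [pow_succ']
    exact Submodule.mul_mem_mul (sub_one_mem_augmentationSpan ρ U hv) hu'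

theorem commutator_le_augmentationSubgroup : ⁅U, U⁆ ≤ augmentationSubgroup ρ U 1 :=
  Subgroup.commutator_le.2 fun _ hu _ hv => commutator_mem_augmentationSubgroup ρ U
    (k := 0) ⟨hu, by simpa using sub_one_mem_augmentationSpan ρ U hu⟩ hv

/-- Kolchin's theorem in characteristic zero, for the augmentation span of a group of unipotent
operators. -/
theorem exists_augmentationSpan_pow_eq_bot [CharZero F] [FiniteDimensional F V]
    (hU : ∀ u ∈ U, IsNilpotent (ρ u - 1)) : ∃ N, augmentationSpan ρ U ^ N = ⊥ := by
  refine exists_submodule_pow_eq_bot _ (augmentationSpan_mul_le ρ U) fun x hx => ?_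
  have htrace : augmentationSpan ρ U ≤ LinearMap.ker (LinearMap.trace F V) := by
    refine Submodule.span_le.2 ?_
    rintro _ ⟨u, hu, rfl⟩
    exact (LinearMap.isNilpotent_trace_of_isNilpotent (hU u hu)).eq_zero
  refine isNilpotent_of_trace_pow_eq_zero x fun k => htrace ?_
  induction k with
  | zero => simpa using hx
  | succ k ih =>
    rw [pow_succ]
    exact augmentationSpan_mul_le ρ U (Submodule.mul_mem_mul ih hx)

theorem isNilpotent_of_augmentationSpan_pow_eq_bot (hρ : Function.Injective ρ) {N : ℕ}
    (hN : augmentationSpan ρ U ^ N = ⊥) : Group.IsNilpotent U := by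
  refine (Subgroup.nilpotent_iff_finite_descending_central_series U).2
    ⟨N, fun k => (augmentationSubgroup ρ U k).subgroupOf U, ⟨?_, ?_⟩, ?_⟩
  · refine Subgroup.subgroupOf_eq_top.2 fun u hu => ⟨hu, ?_⟩
    simpa using sub_one_mem_augmentationSpan ρ U hu
  · intro x k hx g
    exact commutator_mem_augmentationSubgroup ρ U hx g.2
  · refine (Subgroup.eq_bot_iff_forall _).2 fun x hx => ?_
    have h := hx.2
    rw [pow_succ, hN, Submodule.bot_mul, Submodule.mem_bot, sub_eq_zero] at h
    exact Subtype.ext (hρ (h.trans (map_one ρ).symm))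

section Torus

variable {ρ U} {t : Γ} (htriv : ∀ u ∈ U, t * u * t⁻¹ * u⁻¹ ∈ ⁅U, U⁆)
include htriv

/-- Conjugation by `t` is trivial on the successive quotients of the powers of the augmentation
span as soon as it is trivial on the abelianization. -/
theorem conj_sub_mem_augmentationSpan_pow (k : ℕ) {x : End F V}
    (hx : x ∈ augmentationSpan ρ U ^ (k + 1)) :
    ρ t * x * ρ t⁻¹ - x ∈ augmentationSpan ρ U ^ (k + 2) := by
  have base : ∀ x ∈ augmentationSpan ρ U,
      ρ t * x * ρ t⁻¹ - x ∈ augmentationSpan ρ U ^ 2 := by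
    intro x hx
    induction hx using Submodule.span_induction with
    | mem x hx =>
      obtain ⟨u, hu, rfl⟩ := hx
      have h : ρ t * (ρ u - 1) * ρ t⁻¹ - (ρ u - 1) = (ρ (t * u * t⁻¹ * u⁻¹) - 1) * ρ u := by
        rw [sub_mul _ _ (ρ u), ← map_mul, inv_mul_cancel_right, map_mul, map_mul, mul_sub, sub_mul,
          mul_one, map_mul_inv_cancel, one_mul]
        noncomm_ring
      change ρ t * (ρ u - 1) * ρ t⁻¹ - (ρ u - 1) ∈ _
      rw [h]
      exact mul_mem_augmentationSpan_pow ρ U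
        (commutator_le_augmentationSubgroup ρ U (htriv u hu)).2 hu
    | zero => simp
    | add x y _ _ hx hy =>
      have h : ρ t * (x + y) * ρ t⁻¹ - (x + y) =
        (ρ t * x * ρ t⁻¹ - x) + (ρ t * y * ρ t⁻¹ - y) := by noncomm_ring
      rw [h]
      exact add_mem hx hy
    | smul a x _ hx =>
      have h : ρ t * (a • x) * ρ t⁻¹ - a • x = a • (ρ t * x * ρ t⁻¹ - x) := by
        rw [mul_smul_comm, smul_mul_assoc, smul_sub]
      rw [h]
      exact Submodule.smul_mem _ _ hx
  induction k generalizing x with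
  | zero => exact base x (by simpa using hx)
  | succ k ih =>
    rw [pow_succ] at hx
    induction hx using Submodule.mul_induction_on' with
    | mem_mul_mem x hx y hy =>
      have hty : ρ t * y * ρ t⁻¹ ∈ augmentationSpan ρ U := by
        have h := augmentationSpan_pow_succ_le ρ U 0 (base y hy)
        rw [zero_add, pow_one] at h
        simpa using add_mem h hy
      have hinv : ρ t⁻¹ * ρ t = 1 := by rw [← map_mul, inv_mul_cancel, map_one]
      have h : ρ t * (x * y) * ρ t⁻¹ - x * y =
          (ρ t * x * ρ t⁻¹ - x) * (ρ t * y * ρ t⁻¹) + x * (ρ t * y * ρ t⁻¹ - y) := by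
        have h1 : ρ t * x * ρ t⁻¹ * (ρ t * y * ρ t⁻¹) = ρ t * (x * y) * ρ t⁻¹ := by
          calc _ = ρ t * x * (ρ t⁻¹ * ρ t) * y * ρ t⁻¹ := by noncomm_ring
            _ = _ := by rw [hinv, mul_one]; noncomm_ring
        rw [sub_mul, h1, mul_sub]
        abel
      rw [h]
      refine add_mem ?_ ?_
      · rw [pow_succ]
        exact Submodule.mul_mem_mul (ih hx) hty
      · rw [show k + 1 + 2 = (k + 1) + 2 from rfl, pow_add]
        exact Submodule.mul_mem_mul hx (base y hy)
    | add x _ y _ hx hy =>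
      have h : ρ t * (x + y) * ρ t⁻¹ - (x + y) =
        (ρ t * x * ρ t⁻¹ - x) + (ρ t * y * ρ t⁻¹ - y) := by noncomm_ring
      rw [h]
      exact add_mem hx hy

attribute [local instance] LieRing.ofAssociativeRing

/-- A semisimple element acting trivially on the abelianization of a unipotent group centralizes
it. -/
theorem commute_of_isSemisimple_of_trivial_on_abelianization [PerfectField F]
    [FiniteDimensional F V] {N : ℕ} (hN : augmentationSpan ρ U ^ N = ⊥)
    (hss : (ρ t).IsSemisimple) {u : Γ} (hu : u ∈ U) : Commute (ρ t) (ρ u) := by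
  have key : ∀ k, ∃ y ∈ augmentationSpan ρ U ^ (k + 1),
      ((LieAlgebra.ad F (End F V) (ρ t)) ^ k) (ρ u - 1) = y * ρ t ^ k := by
    intro k
    induction k with
    | zero => exact ⟨ρ u - 1, by simpa using sub_one_mem_augmentationSpan ρ U hu, by simp⟩
    | succ k ih =>
      obtain ⟨y, hy, h⟩ := ih
      refine ⟨_, conj_sub_mem_augmentationSpan_pow htriv k hy, ?_⟩
      have hinv : ρ t⁻¹ * ρ t = 1 := by rw [← map_mul, inv_mul_cancel, map_one]
      rw [pow_succ' (LieAlgebra.ad F (End F V) (ρ t)), End.mul_apply, h, LieAlgebra.ad_apply,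
        Ring.lie_def, pow_succ' (ρ t), sub_mul, mul_assoc (ρ t * y), ← mul_assoc (ρ t⁻¹), hinv,
        one_mul, mul_assoc y, ← pow_succ, ← pow_succ', mul_assoc (ρ t)]
  have hgen : ρ u - 1 ∈ (LieAlgebra.ad F (End F V) (ρ t)).maxGenEigenspace 0 := by
    rw [End.mem_maxGenEigenspace]
    obtain ⟨y, hy, h⟩ := key N
    rw [pow_succ, hN, Submodule.bot_mul, Submodule.mem_bot] at hy
    exact ⟨N, by rw [zero_smul, sub_zero, h, hy, zero_mul]⟩
  rw [(LieAlgebra.ad_isSemisimple_of_isSemisimple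
    hss).isFinitelySemisimple.maxGenEigenspace_eq_eigenspace, End.mem_eigenspace_iff, zero_smul,
    LieAlgebra.ad_apply, Ring.lie_def, sub_eq_zero] at hgen
  have h : Commute (ρ t) (ρ u - 1) := hgen
  simpa using h.add_right (Commute.one_right _)

end Torus

/-- A group that is a product of commuting nilpotent subgroups is nilpotent. -/
theorem isNilpotent_of_commuting_product {G H K : Subgroup Γ} [Group.IsNilpotent H]
    [Group.IsNilpotent K] (hH : H ≤ G) (hK : K ≤ G) (hcomm : ∀ h ∈ H, ∀ k ∈ K, Commute h k)
    (hprod : ∀ g ∈ G, ∃ h ∈ H, ∃ k ∈ K, g = h * k) : Group.IsNilpotent G := by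
  refine Group.nilpotent_of_surjective
    ((Subgroup.inclusion hH).noncommCoprod (Subgroup.inclusion hK)
      fun h k => Subtype.ext (hcomm h h.2 k k.2)) ?_
  rintro ⟨g, hg⟩
  obtain ⟨h, hh, k, hk, rfl⟩ := hprod g hg
  exact ⟨(⟨h, hh⟩, ⟨k, hk⟩), rfl⟩

end UnipotentGroups

/-- Let `G` be a connected solvable linear algebraic group over a field `F` of
characteristic `0`, with unipotent radical `U` (the subgroup of all unipotent
elements of `G`) and maximal torus `T`, such that `G = T ⋉ U`.  If `T` acts
trivially by conjugation on `U/[U,U]`, then `T` and `U` commute elementwise, so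
`G ≅ T × U`; in particular `G` is nilpotent. -/
theorem statement6 (F : Type) [Field F] [CharZero F] (n : ℕ)
    (G U T : Subgroup (GL (Fin n) F))
    (hGconn : IsConnectedAlgSubgroup F n G) (hGsolv : IsSolvable ↥G)
    (hUalg : IsAlgebraicSubgroup F n U) (hUG : U ≤ G)
    (hUnormal : ∀ g ∈ G, ∀ u ∈ U, g * u * g⁻¹ ∈ U)
    (hUunip : ∀ u ∈ U, IsUnipotentElt F n u)
    (hUall : ∀ g ∈ G, IsUnipotentElt F n g → g ∈ U)
    (hTalg : IsAlgebraicSubgroup F n T) (hTG : T ≤ G)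
    (hTcomm : ∀ t ∈ T, ∀ t' ∈ T, Commute t t')
    (hTss : ∀ t ∈ T, IsSemisimpleElt F n t)
    (hTconn : IsConnectedAlgSubgroup F n T)
    (hTmax : ∀ T' : Subgroup (GL (Fin n) F), IsAlgebraicSubgroup F n T' →
      T' ≤ G → (∀ t ∈ T', ∀ t' ∈ T', Commute t t') →
      (∀ t ∈ T', IsSemisimpleElt F n t) → T ≤ T' → T' = T)
    (hprod : ∀ g ∈ G, ∃ t ∈ T, ∃ u ∈ U, g = t * u)
    (hint : T ⊓ U = ⊥)
    (htriv : ∀ t ∈ T, ∀ u ∈ U, t * u * t⁻¹ * u⁻¹ ∈ ⁅U, U⁆) :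
    (∀ t ∈ T, ∀ u ∈ U, Commute t u) ∧ Group.IsNilpotent ↥G := by
  let ρ : GL (Fin n) F →* Module.End F (Fin n → F) :=
    (Matrix.toLinAlgEquiv' : Matrix (Fin n) (Fin n) F ≃ₐ[F] _).toMonoidHom.comp
      (Units.coeHom (Matrix (Fin n) (Fin n) F))
  have hρ : Function.Injective ρ :=
    (Matrix.toLinAlgEquiv' : Matrix (Fin n) (Fin n) F ≃ₐ[F] _).injective.comp Units.val_injective
  have hunip : ∀ u ∈ U, IsNilpotent (ρ u - 1) := by
    intro u hu
    have h := (hUunip u hu).map (Matrix.toLinAlgEquiv' : Matrix (Fin n) (Fin n) F ≃ₐ[F] _)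
    rwa [map_sub, map_one] at h
  obtain ⟨N, hN⟩ := exists_augmentationSpan_pow_eq_bot ρ U hunip
  have hcomm : ∀ t ∈ T, ∀ u ∈ U, Commute t u := by
    intro t ht u hu
    have h := commute_of_isSemisimple_of_trivial_on_abelianization (ρ := ρ) (htriv t ht) hN
      (hTss t ht) hu
    exact hρ (by simpa only [map_mul] using h.eq)
  have hUnil : Group.IsNilpotent U := isNilpotent_of_augmentationSpan_pow_eq_bot ρ U hρ hN
  have hTnil : Group.IsNilpotent T :=
    letI : CommGroup T :=
      { (inferInstance : Group T) with
        mul_comm := fun a b => Subtype.ext (hTcomm a a.2 b b.2) }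
    CommGroup.isNilpotent
  exact ⟨hcomm, isNilpotent_of_commuting_product hTG hUG hcomm hprod⟩
end

section
/- Let G be a linear algebraic group over a field of characteristic 0 and N(G) its maximal normal reductive subgroup. Every normal reductive algebraic subgroup of G is contained in N(G), and if f: G → G' is a homomorphism of algebraic groups with f(G) normal in G', then f(N(G)) ⊆ N(G'). -/
open Matrix

/-- An algebraic subgroup `M` of `GL n F` is reductive (char 0) if it has no
nontrivial connected normal algebraic subgroup consisting of unipotent
elements. -/
def IsReductiveSubgroup (F : Type) [Field F] (n : ℕ)
    (M : Subgroup (GL (Fin n) F)) : Prop :=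
  ∀ H : Subgroup (GL (Fin n) F), IsAlgebraicSubgroup F n H → H ≤ M →
    (∀ m ∈ M, ∀ h ∈ H, m * h * m⁻¹ ∈ H) → IsConnectedAlgSubgroup F n H →
    (∀ h ∈ H, IsUnipotentElt F n h) → H = ⊥

/-- `U` is the unipotent radical of the algebraic subgroup `G`: the maximal
connected normal algebraic subgroup of `G` consisting of unipotent elements. -/
def IsUnipotentRadical (F : Type) [Field F] (n : ℕ)
    (G U : Subgroup (GL (Fin n) F)) : Prop :=
  IsAlgebraicSubgroup F n G ∧ IsAlgebraicSubgroup F n U ∧ U ≤ G ∧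
  (∀ g ∈ G, ∀ u ∈ U, g * u * g⁻¹ ∈ U) ∧ IsConnectedAlgSubgroup F n U ∧
  (∀ u ∈ U, IsUnipotentElt F n u) ∧
  (∀ H : Subgroup (GL (Fin n) F), IsAlgebraicSubgroup F n H → H ≤ G →
    (∀ g ∈ G, ∀ h ∈ H, g * h * g⁻¹ ∈ H) → IsConnectedAlgSubgroup F n H →
    (∀ h ∈ H, IsUnipotentElt F n h) → H ≤ U)

/-- `M = N(G)`: with `V` the centralizer of the unipotent radical `U` in `G`
and `W = V ⊓ U`, `M` is the (unique algebraic) complement of `W` in `V`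
provided by the unique splitting of `1 → W → V → V/W → 1`. -/
def IsNGroup (F : Type) [Field F] (n : ℕ)
    (G U M : Subgroup (GL (Fin n) F)) : Prop :=
  IsUnipotentRadical F n G U ∧
  IsAlgebraicSubgroup F n M ∧
  M ≤ Subgroup.centralizer (U : Set (GL (Fin n) F)) ⊓ G ∧
  M ⊓ (Subgroup.centralizer (U : Set (GL (Fin n) F)) ⊓ G ⊓ U) = ⊥ ∧
  ∀ v ∈ Subgroup.centralizer (U : Set (GL (Fin n) F)) ⊓ G,
    ∃ x ∈ M, ∃ w ∈ Subgroup.centralizer (U : Set (GL (Fin n) F)) ⊓ G ⊓ U,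
      v = x * w

/-- `f : G → GL m F` is a morphism of algebraic groups: each matrix entry of
`f g` is a polynomial in the entries of `g` and the inverse determinant. -/
def IsPolynomialHom (F : Type) [Field F] (n m : ℕ)
    (G : Subgroup (GL (Fin n) F)) (f : ↥G →* GL (Fin m) F) : Prop :=
  ∃ P : Fin m × Fin m → MvPolynomial ((Fin n × Fin n) ⊕ Unit) F,
    ∀ (g : ↥G) (i j : Fin m),
      ((f g : GL (Fin m) F) : Matrix (Fin m) (Fin m) F) i j =
        MvPolynomial.eval
          (Sum.elim
            (fun kl => ((g : GL (Fin n) F) : Matrix (Fin n) (Fin n) F) kl.1 kl.2)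
            (fun _ => (((g : GL (Fin n) F) : Matrix (Fin n) (Fin n) F)).det⁻¹))
          (P (i, j))

section LinearAlgebra

variable {F : Type} [Field F] {n : ℕ}

/-- The span of all commutators `x * y - y * x` with `x ∈ A` and `y ∈ B`. -/
def brk (A B : Submodule F (Matrix (Fin n) (Fin n) F)) :
    Submodule F (Matrix (Fin n) (Fin n) F) :=
  Submodule.span F {z | ∃ x ∈ A, ∃ y ∈ B, z = x * y - y * x}

theorem mul_sub_mul_mem_brk {A B : Submodule F (Matrix (Fin n) (Fin n) F)}
    {x y : Matrix (Fin n) (Fin n) F} (hx : x ∈ A) (hy : y ∈ B) : x * y - y * x ∈ brk A B :=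
  Submodule.subset_span ⟨x, hx, y, hy, rfl⟩

theorem brk_le {A B C : Submodule F (Matrix (Fin n) (Fin n) F)}
    (h : ∀ x ∈ A, ∀ y ∈ B, x * y - y * x ∈ C) : brk A B ≤ C :=
  Submodule.span_le.2 (by rintro _ ⟨x, hx, y, hy, rfl⟩; exact h x hx y hy)

theorem isNilpotent_toLin'_iff {x : Matrix (Fin n) (Fin n) F} :
    IsNilpotent (Matrix.toLin' x) ↔ IsNilpotent x := by
  refine IsNilpotent.map_iff (f := Matrix.toLinAlgEquiv' (R := F) (n := Fin n)) ?_
  exact AlgEquiv.injective _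

theorem isNilpotent_of_trace_pow_eq_zero_s13 [CharZero F] {y : Matrix (Fin n) (Fin n) F}
    (h : ∀ k, (y ^ (k + 1)).trace = 0) : IsNilpotent y := by
  have hp : minpoly F y ≠ 0 := minpoly.ne_zero (Algebra.IsIntegral.isIntegral y)
  obtain ⟨r, hr, hnd⟩ := Polynomial.exists_eq_pow_rootMultiplicity_mul_and_not_dvd _ hp 0
  set a := (minpoly F y).rootMultiplicity 0
  simp only [map_zero, sub_zero] at hr hnd
  have hcop : IsCoprime (Polynomial.X ^ (a + 1) : Polynomial F) r :=
    IsCoprime.pow_left ((Polynomial.irreducible_X.coprime_iff_not_dvd).2 hnd)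
  obtain ⟨u, v, huv⟩ := hcop
  have key : ∀ q : Polynomial F, (Polynomial.aeval y (q * Polynomial.X)).trace = 0 := by
    intro q
    induction q using Polynomial.induction_on' with
    | add p q hp hq => rw [add_mul, map_add, trace_add, hp, hq, add_zero]
    | monomial k c => simp [Polynomial.aeval_monomial, ← Algebra.smul_def, h]
  set e := Polynomial.aeval y (u * Polynomial.X ^ (a + 1)) with he
  have hmin : ∀ q, Polynomial.aeval y (minpoly F y * q) = 0 := by
    intro q; rw [map_mul, minpoly.aeval, zero_mul]
  have hidem : e * e = e := by
    have h1 : u * Polynomial.X ^ (a + 1) * (u * Polynomial.X ^ (a + 1)) =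
        u * Polynomial.X ^ (a + 1) - minpoly F y * (u * Polynomial.X * v) := by
      rw [hr]; linear_combination (u * Polynomial.X ^ (a + 1)) * huv
    rw [he, ← map_mul, h1, map_sub, hmin, sub_zero]
  have htr : e.trace = 0 := by
    rw [he, pow_succ, ← mul_assoc]; exact key _
  have he0 : e = 0 := by
    have h1 : IsIdempotentElem (Matrix.toLin' e) := by
      unfold IsIdempotentElem
      rw [Module.End.mul_eq_comp, ← Matrix.toLin'_mul, hidem]
    have h2 : LinearMap.trace F (Fin n → F) (Matrix.toLin' e) = 0 := by
      rw [Matrix.trace_toLin'_eq, htr]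
    have := LinearMap.IsIdempotentElem.eq_zero_of_trace_eq_zero h1 h2
    simpa using this
  refine ⟨a, ?_⟩
  have h2 : (Polynomial.X ^ a : Polynomial F) =
      Polynomial.X ^ a * (u * Polynomial.X ^ (a + 1)) + minpoly F y * v := by
    rw [hr]; linear_combination (-Polynomial.X ^ a : Polynomial F) * huv
  have h3 := congrArg (Polynomial.aeval y) h2
  rw [map_add, hmin, map_mul, ← he, he0] at h3
  simpa using h3

attribute [local instance] LieRing.ofAssociativeRing

/-- The Lie algebra of endomorphisms attached to a space of matrices closed under commutators. -/
def toLieSubalgebra (k : Submodule F (Matrix (Fin n) (Fin n) F))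
    (hb : ∀ x ∈ k, ∀ y ∈ k, x * y - y * x ∈ k) :
    LieSubalgebra F (Module.End F (Fin n → F)) :=
  { k.map (Matrix.toLin' : _ ≃ₗ[F] _).toLinearMap with
    lie_mem' := by
      rintro _ _ ⟨x, hx, rfl⟩ ⟨y, hy, rfl⟩
      refine ⟨x * y - y * x, hb x hx y hy, ?_⟩
      simp [Ring.lie_def, Module.End.mul_eq_comp] }

theorem exists_pow_eq_bot (k : Submodule F (Matrix (Fin n) (Fin n) F))
    (hb : ∀ x ∈ k, ∀ y ∈ k, x * y - y * x ∈ k) (hn : ∀ x ∈ k, IsNilpotent x) :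
    ∃ N, k ^ N = ⊥ := by
  set L := toLieSubalgebra k hb
  have hnil : LieModule.IsNilpotent L (Fin n → F) := by
    rw [LieModule.isNilpotent_iff_forall' (R := F)]
    rintro ⟨_, x, hx, rfl⟩
    exact isNilpotent_toLin'_iff.2 (hn x hx)
  obtain ⟨N, hN⟩ := (LieModule.isNilpotent_iff F L (Fin n → F)).1 hnil
  refine ⟨N, ?_⟩
  have key : ∀ (m : ℕ), ∀ p ∈ k ^ m, ∀ v,
      p *ᵥ v ∈ LieModule.lowerCentralSeries F L (Fin n → F) m := by
    intro m
    induction m with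
    | zero => simp
    | succ m ih =>
      intro p hp v
      rw [pow_succ'] at hp
      refine Submodule.mul_induction_on hp ?_ ?_
      · intro x hx q hq
        rw [LieModule.lowerCentralSeries_succ, ← mulVec_mulVec]
        have hx : Matrix.toLin' x ∈ L := ⟨x, hx, rfl⟩
        exact LieSubmodule.lie_mem_lie (x := (⟨Matrix.toLin' x, hx⟩ : L)) (by simp) (ih q hq v)
      · intro x y hx hy
        rw [add_mulVec]
        exact add_mem hx hy
  rw [eq_bot_iff]
  intro p hp
  have h := key N p hp
  rw [hN] at h
  rw [Submodule.mem_bot]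
  apply Matrix.toLin'.injective
  refine LinearMap.ext fun v => ?_
  simpa using h v

theorem isNilpotent_of_mem_brk [CharZero F] (k : Submodule F (Matrix (Fin n) (Fin n) F))
    (hb : ∀ x ∈ k, ∀ y ∈ k, x * y - y * x ∈ k) (ht : ∀ x ∈ k, ∀ y ∈ k, (x * y).trace = 0)
    {z : Matrix (Fin n) (Fin n) F} (hz : z ∈ brk k k) : IsNilpotent z := by
  set L := toLieSubalgebra k hb
  have hform : LieModule.traceForm F L (Fin n → F) = 0 := by
    ext ⟨_, x, hx, rfl⟩ ⟨_, y, hy, rfl⟩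
    have := ht x hx y hy
    rw [← Matrix.trace_toLin'_eq, Matrix.toLin'_mul] at this
    exact this
  have hnil := LieModule.isNilpotent_derivedSeries_of_traceForm_eq_zero hform
  rw [LieModule.isNilpotent_iff_forall' (R := F)] at hnil
  have hzm : ∃ h : Matrix.toLin' z ∈ L, (⟨Matrix.toLin' z, h⟩ : L) ∈
      LieAlgebra.derivedSeries F L 1 := by
    refine Submodule.span_induction ?_ ?_ ?_ ?_ hz
    · rintro _ ⟨x, hx, y, hy, rfl⟩
      have hx' : Matrix.toLin' x ∈ L := ⟨x, hx, rfl⟩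
      have hy' : Matrix.toLin' y ∈ L := ⟨y, hy, rfl⟩
      refine ⟨⟨_, hb x hx y hy, rfl⟩, ?_⟩
      have h1 : ⁅(⟨_, hx'⟩ : L), (⟨_, hy'⟩ : L)⁆ ∈ LieAlgebra.derivedSeries F L 1 := by
        rw [LieAlgebra.derivedSeries_def, LieAlgebra.derivedSeriesOfIdeal_succ]
        exact LieSubmodule.lie_mem_lie (by simp) (by simp)
      convert h1 using 1
      ext1
      simp [Ring.lie_def, Module.End.mul_eq_comp]
    · refine ⟨by simp, ?_⟩
      convert (LieAlgebra.derivedSeries F L 1).zero_mem using 1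
      ext1; simp
    · rintro x y - - ⟨hx, hx'⟩ ⟨hy, hy'⟩
      refine ⟨by simpa using L.add_mem hx hy, ?_⟩
      have h := (LieAlgebra.derivedSeries F L 1).add_mem hx' hy'
      simp only [map_add]
      exact h
    · rintro c x - ⟨hx, hx'⟩
      refine ⟨by simpa using L.smul_mem c hx, ?_⟩
      have h := (LieAlgebra.derivedSeries F L 1).smul_mem c hx'
      simp only [map_smul]
      exact h
  obtain ⟨h1, h2⟩ := hzm
  exact isNilpotent_toLin'_iff.1 (hnil ⟨⟨_, h1⟩, h2⟩)

/-- A space of nilpotent matrices which is a perfect Lie algebra is zero. -/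
theorem eq_bot_of_le_brk {q : Submodule F (Matrix (Fin n) (Fin n) F)}
    (hb : ∀ x ∈ q, ∀ y ∈ q, x * y - y * x ∈ q) (hn : ∀ x ∈ q, IsNilpotent x)
    (hq : q ≤ brk q q) : q = ⊥ := by
  obtain ⟨N, hN⟩ := exists_pow_eq_bot q hb hn
  have h2 : q ≤ q * q := hq.trans <| brk_le fun x hx y hy =>
    sub_mem (Submodule.mul_mem_mul hx hy) (Submodule.mul_mem_mul hy hx)
  have h3 : ∀ k, q ≤ q ^ (k + 1) := by
    intro k
    induction k with
    | zero => simp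
    | succ k ih =>
      rw [pow_succ']
      exact h2.trans (Submodule.mul_le.2 fun a ha b hb => Submodule.mul_mem_mul ha (ih hb))
  rw [eq_bot_iff]
  refine (h3 N).trans ?_
  rw [pow_succ, hN]; simp

theorem map_mem_brk {m : ℕ} {A B : Submodule F (Matrix (Fin n) (Fin n) F)}
    {A' B' : Submodule F (Matrix (Fin m) (Fin m) F)}
    (φ : Matrix (Fin n) (Fin n) F →ₗ[F] Matrix (Fin m) (Fin m) F)
    (hφ : ∀ x ∈ A, ∀ y ∈ B, φ (x * y - y * x) = φ x * φ y - φ y * φ x)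
    (hA : ∀ x ∈ A, φ x ∈ A') (hB : ∀ x ∈ B, φ x ∈ B') {z : Matrix (Fin n) (Fin n) F}
    (hz : z ∈ brk A B) : φ z ∈ brk A' B' := by
  have : brk A B ≤ (brk A' B').comap φ := brk_le fun x hx y hy => by
    rw [Submodule.mem_comap, hφ x hx y hy]
    exact mul_sub_mul_mem_brk (hA x hx) (hB y hy)
  exact this hz

/-- Conjugation by an invertible matrix. -/
def conjHom (g : GL (Fin n) F) : Matrix (Fin n) (Fin n) F →ₐ[F] Matrix (Fin n) (Fin n) F :=
  AlgHom.ofLinearMap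
    ((LinearMap.mulLeft F (g : Matrix (Fin n) (Fin n) F)) ∘ₗ
      (LinearMap.mulRight F (↑(g⁻¹) : Matrix (Fin n) (Fin n) F)))
    (by rw [LinearMap.comp_apply, LinearMap.mulLeft_apply, LinearMap.mulRight_apply, one_mul,
      Units.mul_inv])
    (by
      intro x y
      simp only [LinearMap.comp_apply, LinearMap.mulLeft_apply, LinearMap.mulRight_apply]
      calc _ = (g : Matrix (Fin n) (Fin n) F) * (x * 1 * (y * ↑(g⁻¹))) := by
            rw [mul_one, mul_assoc x]
        _ = _ := by rw [← Units.inv_mul g]; simp only [mul_assoc])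

theorem conjHom_apply (g : GL (Fin n) F) (x : Matrix (Fin n) (Fin n) F) :
    conjHom g x = g * x * (↑(g⁻¹) : Matrix (Fin n) (Fin n) F) := by
  simp [conjHom, mul_assoc]

theorem trace_conjHom_mul (g : GL (Fin n) F) (x y : Matrix (Fin n) (Fin n) F) :
    (conjHom g x * y).trace = (x * conjHom g⁻¹ y).trace := by
  rw [conjHom_apply, conjHom_apply, inv_inv, mul_assoc, mul_assoc, trace_mul_comm]
  simp only [mul_assoc]

theorem trace_eq_zero_of_isNilpotent {x : Matrix (Fin n) (Fin n) F} (h : IsNilpotent x) :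
    x.trace = 0 :=
  (Matrix.isNilpotent_trace_of_isNilpotent h).eq_zero

theorem conjHom_mem_brk {A B : Submodule F (Matrix (Fin n) (Fin n) F)} {g : GL (Fin n) F}
    (hA : ∀ x ∈ A, conjHom g x ∈ A) (hB : ∀ x ∈ B, conjHom g x ∈ B)
    {z : Matrix (Fin n) (Fin n) F} (hz : z ∈ brk A B) : conjHom g z ∈ brk A B :=
  map_mem_brk (conjHom g).toLinearMap (by simp) hA hB hz

theorem trace_comm_mul (x y z : Matrix (Fin n) (Fin n) F) :
    ((x * y - y * x) * z).trace = (x * (y * z - z * y)).trace := by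
  simp only [sub_mul, mul_sub, trace_sub]
  rw [mul_assoc, mul_assoc y, trace_mul_comm y, mul_assoc x z]

theorem eq_bot_of_conj_stable {Γ : Subgroup (GL (Fin n) F)}
    {k : Submodule F (Matrix (Fin n) (Fin n) F)}
    (hnd : ∀ Y ∈ k, (∀ γ ∈ Γ, (Y * (γ : Matrix (Fin n) (Fin n) F)).trace = 0) → Y = 0)
    (hb : ∀ x ∈ k, ∀ y ∈ k, x * y - y * x ∈ k)
    (hconj : ∀ γ ∈ Γ, ∀ x ∈ k, conjHom γ x ∈ k)
    (hn : ∀ x ∈ k, IsNilpotent x) : k = ⊥ := by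
  obtain ⟨N, hN⟩ := exists_pow_eq_bot k hb hn
  rw [eq_bot_iff]
  intro Y hY
  refine hnd Y hY fun γ hγ => trace_eq_zero_of_isNilpotent ⟨N, ?_⟩
  have key : ∀ j : ℕ, ∃ P ∈ k ^ j, (Y * (γ : Matrix (Fin n) (Fin n) F)) ^ j =
      P * (↑(γ ^ j) : Matrix (Fin n) (Fin n) F) := by
    intro j
    induction j with
    | zero => exact ⟨1, by simpa using ⟨1, map_one _⟩, by simp⟩
    | succ j ih =>
      obtain ⟨P, hP, h⟩ := ih
      refine ⟨P * conjHom (γ ^ j) Y, ?_, ?_⟩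
      · rw [pow_succ]; exact Submodule.mul_mem_mul hP (hconj _ (pow_mem hγ j) Y hY)
      · rw [pow_succ, h, conjHom_apply, pow_succ γ j, Units.val_mul]
        simp only [mul_assoc]
        rw [Units.inv_mul_cancel_left]
  obtain ⟨P, hP, h⟩ := key N
  rw [hN, Submodule.mem_bot] at hP
  rw [h, hP, zero_mul]

/-- A Lie algebra spanned by nilpotent matrices and stable under a group `Γ`, on which the
pairing `(Y, γ) ↦ tr (Y γ)` with `Γ` is nondegenerate, is perfect. -/
theorem span_le_brk_span [CharZero F] {Γ : Subgroup (GL (Fin n) F)}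
    {S : Set (Matrix (Fin n) (Fin n) F)} {L : Submodule F (Matrix (Fin n) (Fin n) F)}
    (hL : L = Submodule.span F S) (hS : ∀ X ∈ S, IsNilpotent X)
    (hb : ∀ x ∈ L, ∀ y ∈ L, x * y - y * x ∈ L)
    (hconj : ∀ γ ∈ Γ, ∀ x ∈ L, conjHom γ x ∈ L)
    (hnd : ∀ Y ∈ L, (∀ γ ∈ Γ, (Y * (γ : Matrix (Fin n) (Fin n) F)).trace = 0) → Y = 0) :
    L ≤ brk L L := by
  have hE : ∀ k ≤ L, (∀ x ∈ k, ∀ y ∈ k, x * y - y * x ∈ k) →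
      (∀ γ ∈ Γ, ∀ x ∈ k, conjHom γ x ∈ k) → (∀ x ∈ k, IsNilpotent x) → k = ⊥ :=
    fun k hk => eq_bot_of_conj_stable fun Y hY => hnd Y (hk hY)
  let N : Submodule F (Matrix (Fin n) (Fin n) F) :=
    { carrier := {Y | Y ∈ L ∧ ∀ Z ∈ L, (Y * Z).trace = 0}
      add_mem' := fun {a b} ha hb => ⟨add_mem ha.1 hb.1, fun Z hZ => by
        rw [add_mul, trace_add, ha.2 Z hZ, hb.2 Z hZ, add_zero]⟩
      zero_mem' := ⟨zero_mem _, by simp⟩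
      smul_mem' := fun c a ha => ⟨L.smul_mem c ha.1, fun Z hZ => by
        rw [smul_mul_assoc, trace_smul, ha.2 Z hZ, smul_zero]⟩ }
  have hNL : N ≤ L := fun Y hY => hY.1
  have hLN : ∀ x ∈ L, ∀ y ∈ N, x * y - y * x ∈ N := fun x hx y hy =>
    ⟨hb x hx y hy.1, fun Z hZ => by
      rw [← neg_sub, neg_mul, trace_neg, trace_comm_mul, hy.2 _ (hb x hx Z hZ), neg_zero]⟩
  have hNconj : ∀ γ ∈ Γ, ∀ x ∈ N, conjHom γ x ∈ N := fun γ hγ x hx =>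
    ⟨hconj γ hγ x hx.1, fun Z hZ => by
      rw [trace_conjHom_mul]; exact hx.2 _ (hconj _ (inv_mem hγ) Z hZ)⟩
  have hNN : ∀ x ∈ N, ∀ y ∈ N, x * y - y * x ∈ N := fun x hx y hy => hLN x (hNL hx) y hy
  have hNN0 : brk N N = ⊥ := by
    have hle : brk N N ≤ N := brk_le hNN
    refine hE _ (hle.trans hNL)
      (fun x hx y hy => mul_sub_mul_mem_brk (hle hx) (hle hy))
      (fun γ hγ x hx => conjHom_mem_brk (hNconj γ hγ) (hNconj γ hγ) hx)
      (fun x hx => isNilpotent_of_mem_brk N hNN (fun a ha b hb => ha.2 b hb.1) hx)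
  have hNcomm : ∀ x ∈ N, ∀ y ∈ N, x * y = y * x := fun x hx y hy => by
    have := mul_sub_mul_mem_brk hx hy
    rw [hNN0, Submodule.mem_bot, sub_eq_zero] at this
    exact this
  have hLN0 : brk L N = ⊥ := by
    have hle : brk L N ≤ N := brk_le hLN
    refine hE _ (hle.trans hNL)
      (fun x hx y hy => mul_sub_mul_mem_brk (hNL (hle hx)) (hle hy))
      (fun γ hγ x hx => conjHom_mem_brk (hconj γ hγ) (hNconj γ hγ) hx)
      (fun y hy => isNilpotent_of_trace_pow_eq_zero_s13 fun k => ?_)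
    have key : ∀ z ∈ brk L N, (y ^ k * z).trace = 0 := by
      intro z hz
      refine Submodule.span_induction ?_ (by simp) ?_ ?_ hz
      · rintro _ ⟨a, ha, b, hb, rfl⟩
        have hyb : Commute (y ^ k) b := Commute.pow_left (hNcomm y (hle hy) b hb) k
        rw [mul_sub, trace_sub, ← mul_assoc, trace_mul_comm, ← mul_assoc, ← mul_assoc, hyb.eq,
          sub_self]
      · intro a b _ _ ha hb
        rw [mul_add, trace_add, ha, hb, add_zero]
      · intro c a _ ha
        rw [mul_smul_comm, trace_smul, ha, smul_zero]
    rw [pow_succ]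
    exact key y hy
  have hcomm : ∀ x ∈ L, ∀ y ∈ N, x * y = y * x := fun x hx y hy => by
    have := mul_sub_mul_mem_brk hx hy
    rw [hLN0, Submodule.mem_bot, sub_eq_zero] at this
    exact this
  have hN0 : N = ⊥ := by
    refine hE N hNL hNN hNconj fun y hy => isNilpotent_of_trace_pow_eq_zero_s13 fun k => ?_
    have key : ∀ z ∈ L, (y ^ k * z).trace = 0 := by
      intro z hz
      rw [hL] at hz
      refine Submodule.span_induction ?_ (by simp) ?_ ?_ hz
      · intro X hX
        have hXy : Commute X (y ^ k) :=
          Commute.pow_right (hcomm X (hL ▸ Submodule.subset_span hX) y hy) k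
        exact trace_eq_zero_of_isNilpotent (hXy.symm.isNilpotent_mul_left (hS X hX))
      · intro a b _ _ ha hb
        rw [mul_add, trace_add, ha, hb, add_zero]
      · intro c a _ ha
        rw [mul_smul_comm, trace_smul, ha, smul_zero]
    rw [pow_succ]
    exact key y (hNL hy)
  have hnondeg : ∀ Y ∈ L, (∀ Z ∈ L, (Y * Z).trace = 0) → Y = 0 := fun Y hY h => by
    have : Y ∈ N := ⟨hY, h⟩
    rwa [hN0] at this
  conv_lhs => rw [hL]
  refine Submodule.span_le.2 fun X hX => ?_
  have hXL : X ∈ L := hL ▸ Submodule.subset_span hX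
  by_contra hXb
  obtain ⟨ψ, hψX, hψ⟩ := Submodule.exists_le_ker_of_notMem hXb
  let β : L →ₗ[F] Module.Dual F L := LinearMap.mk₂ F
    (fun Y Z => ((Y : Matrix (Fin n) (Fin n) F) * (Z : Matrix (Fin n) (Fin n) F)).trace)
    (by simp [add_mul]) (by simp) (by simp [mul_add]) (by simp)
  have hβ : Function.Injective β := by
    rw [← LinearMap.ker_eq_bot, eq_bot_iff]
    rintro ⟨Y, hY⟩ h
    rw [LinearMap.mem_ker] at h
    ext1
    exact hnondeg Y hY fun Z hZ => LinearMap.congr_fun h ⟨Z, hZ⟩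
  have hβs : Function.Surjective β :=
    (LinearMap.injective_iff_surjective_of_finrank_eq_finrank
      (Subspace.dual_finrank_eq).symm).1 hβ
  obtain ⟨⟨C, hC⟩, hCψ⟩ := hβs (ψ ∘ₗ L.subtype)
  have hCψ' : ∀ Z ∈ L, (C * Z).trace = ψ Z := fun Z hZ => LinearMap.congr_fun hCψ ⟨Z, hZ⟩
  have hCX : C * X - X * C = 0 := hnondeg _ (hb C hC X hXL) fun Z hZ => by
    rw [trace_comm_mul, hCψ' _ (hb X hXL Z hZ)]
    exact hψ (mul_sub_mul_mem_brk hXL hZ)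
  have hc : Commute C X := sub_eq_zero.1 hCX
  exact hψX (by
    rw [← hCψ' X hXL, trace_eq_zero_of_isNilpotent (hc.isNilpotent_mul_left (hS X hX))])

end LinearAlgebra

section ExpLog

set_option linter.unusedSectionVars false

theorem sq_dvd_exp_neg_mul_sub_one {A : Type*} [CommRing A] [Algebra ℚ A] {z : A}
    (hz : IsNilpotent z) : z ^ 2 ∣ IsNilpotent.exp (-z) * (1 + z) - 1 := by
  obtain ⟨N, hN⟩ := hz
  have h : (-z) ^ (N + 2) = 0 := by rw [neg_pow, pow_add z, hN]; simp
  rw [IsNilpotent.exp_eq_sum h, Finset.sum_range_succ', Finset.sum_range_succ']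
  have : z ^ 2 ∣ ∑ k ∈ Finset.range N, ((k + 1 + 1).factorial : ℚ)⁻¹ • (-z) ^ (k + 1 + 1) :=
    Finset.dvd_sum fun k _ => by
      refine ⟨((k + 1 + 1).factorial : ℚ)⁻¹ • (-z) ^ k, ?_⟩
      rw [mul_smul_comm]
      congr 1
      ring
  obtain ⟨c, hc⟩ := this
  rw [hc]
  refine ⟨c * (1 + z) - 1, ?_⟩
  simp
  ring

theorem exists_exp_eq_one_add {A : Type*} [CommRing A] [Algebra ℚ A] {x : A} {N : ℕ}
    (hx : x ^ N = 0) (k : ℕ) : ∀ (j : ℕ) (z : A), x ^ (j + 1) ∣ z → N ≤ j + 1 + k →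
      ∃ y, x ∣ y ∧ IsNilpotent.exp y = 1 + z := by
  induction k with
  | zero =>
    intro j z hz hN
    rw [pow_eq_zero_of_le hN hx, zero_dvd_iff] at hz
    exact ⟨0, by simp, by simp [hz, IsNilpotent.exp_zero]⟩
  | succ k ih =>
    intro j z hz hN
    have hnil : ∀ w, x ∣ w → IsNilpotent w := fun w hw =>
      ⟨N, by obtain ⟨c, rfl⟩ := hw; rw [mul_pow, hx, zero_mul]⟩
    have hxz : x ∣ z := (dvd_pow_self x (Nat.succ_ne_zero j)).trans hz
    obtain ⟨y, hy, hexp⟩ := ih (j + 1) (IsNilpotent.exp (-z) * (1 + z) - 1)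
      (((pow_dvd_pow x (by omega : j + 1 + 1 ≤ (j + 1) * 2)).trans
        (by rw [pow_mul]; exact pow_dvd_pow_of_dvd hz 2)).trans
        (sq_dvd_exp_neg_mul_sub_one (hnil z hxz))) (by omega)
    refine ⟨z + y, dvd_add hxz hy, ?_⟩
    rw [IsNilpotent.exp_add_of_commute (Commute.all _ _) (hnil z hxz) (hnil y hy), hexp,
      add_sub_cancel, ← mul_assoc, IsNilpotent.exp_mul_exp_neg_self (hnil z hxz), one_mul]

variable {F : Type} [Field F] [CharZero F] {n : ℕ}

theorem exists_exp_eq (u : Matrix (Fin n) (Fin n) F) (hu : IsNilpotent (u - 1)) :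
    ∃ X, IsNilpotent X ∧ IsNilpotent.exp X = u ∧ ∃ q : Polynomial F, X = Polynomial.aeval u q := by
  obtain ⟨N, hN⟩ := hu
  let I : Ideal (Polynomial F) := Ideal.span {Polynomial.X ^ N}
  have hlift : ∀ a : Polynomial F, a ∈ I → Polynomial.aeval (u - 1) a = 0 := by
    intro a ha
    obtain ⟨c, rfl⟩ := Ideal.mem_span_singleton.1 ha
    simp [hN]
  let φ := Ideal.Quotient.liftₐ I (Polynomial.aeval (u - 1)) hlift
  let x : Polynomial F ⧸ I := Ideal.Quotient.mk I Polynomial.X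
  have hx : x ^ N = 0 := by
    rw [← map_pow, Ideal.Quotient.eq_zero_iff_mem]
    exact Ideal.mem_span_singleton_self _
  obtain ⟨y, ⟨c, hy⟩, hexp⟩ := exists_exp_eq_one_add hx N 0 x (by simp) (by omega)
  have hynil : IsNilpotent y := ⟨N, by rw [hy, mul_pow, hx, zero_mul]⟩
  have hφx : φ x = u - 1 := by
    change Ideal.Quotient.lift I _ hlift (Ideal.Quotient.mk I _) = _
    rw [Ideal.Quotient.lift_mk]
    simp
  refine ⟨φ y, hynil.map φ, ?_, ?_⟩
  · rw [← IsNilpotent.map_exp hynil φ, hexp, map_add, map_one, hφx]; simp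
  · obtain ⟨q, rfl⟩ := Ideal.Quotient.mk_surjective y
    refine ⟨q.comp (Polynomial.X - 1), ?_⟩
    rw [Polynomial.aeval_comp]
    change Ideal.Quotient.lift I _ hlift (Ideal.Quotient.mk I _) = _
    rw [Ideal.Quotient.lift_mk]
    simp

/-- The invertible matrix `exp X` for a nilpotent matrix `X` (and `1` otherwise). -/
noncomputable def gexp (X : Matrix (Fin n) (Fin n) F) : GL (Fin n) F :=
  open Classical in if h : IsNilpotent X then (IsNilpotent.isUnit_exp h).unit else 1

theorem coe_gexp {X : Matrix (Fin n) (Fin n) F} (h : IsNilpotent X) :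
    (gexp X : Matrix (Fin n) (Fin n) F) = IsNilpotent.exp X := by
  simp [gexp, h]

theorem gexp_zero : gexp (0 : Matrix (Fin n) (Fin n) F) = 1 :=
  Units.ext (by rw [coe_gexp IsNilpotent.zero, IsNilpotent.exp_zero, Units.val_one])

theorem gexp_add {X Y : Matrix (Fin n) (Fin n) F} (hX : IsNilpotent X) (hY : IsNilpotent Y)
    (h : Commute X Y) : gexp (X + Y) = gexp X * gexp Y :=
  Units.ext (by
    rw [coe_gexp (h.isNilpotent_add hX hY), Units.val_mul, coe_gexp hX, coe_gexp hY,
      IsNilpotent.exp_add_of_commute h hX hY])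

theorem gexp_neg {X : Matrix (Fin n) (Fin n) F} (hX : IsNilpotent X) :
    gexp (-X) = (gexp X)⁻¹ := by
  rw [eq_inv_iff_mul_eq_one, ← gexp_add hX.neg hX (Commute.neg_left rfl), neg_add_cancel,
    gexp_zero]

theorem gexp_nat_smul {X : Matrix (Fin n) (Fin n) F} (hX : IsNilpotent X) (k : ℕ) :
    gexp ((k : F) • X) = gexp X ^ k := by
  induction k with
  | zero => simp [gexp_zero]
  | succ k ih =>
    rw [Nat.cast_succ, add_smul, one_smul, gexp_add (hX.smul _) hX (Commute.smul_left rfl _), ih,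
      pow_succ]

theorem isNilpotent_conjHom (g : GL (Fin n) F) {X : Matrix (Fin n) (Fin n) F}
    (hX : IsNilpotent X) : IsNilpotent (conjHom g X) := hX.map _

theorem gexp_conjHom (g : GL (Fin n) F) {X : Matrix (Fin n) (Fin n) F} (hX : IsNilpotent X) :
    gexp (conjHom g X) = g * gexp X * g⁻¹ :=
  Units.ext (by
    rw [coe_gexp (isNilpotent_conjHom g hX), ← IsNilpotent.map_exp hX (conjHom g), conjHom_apply,
      Units.val_mul, Units.val_mul, coe_gexp hX])

theorem isUnipotentElt_gexp {X : Matrix (Fin n) (Fin n) F} (hX : IsNilpotent X) :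
    IsUnipotentElt F n (gexp X) := by
  rw [IsUnipotentElt, coe_gexp hX]
  exact IsNilpotent.isNilpotent_exp_sub_one hX

theorem exists_gexp_eq {u : GL (Fin n) F} (hu : IsUnipotentElt F n u) :
    ∃ X, IsNilpotent X ∧ gexp X = u ∧
      ∃ q : Polynomial F, X = Polynomial.aeval (u : Matrix (Fin n) (Fin n) F) q := by
  obtain ⟨X, hX, h, h'⟩ := exists_exp_eq _ hu
  exact ⟨X, hX, Units.ext (by rw [coe_gexp hX, h]), h'⟩

/-- The matrix of polynomials in `t` representing `exp (t X)`. -/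
noncomputable def pexp (X : Matrix (Fin n) (Fin n) F) :
    Matrix (Fin n) (Fin n) (Polynomial F) :=
  ∑ k ∈ Finset.range (nilpotencyClass X), (Polynomial.X ^ k : Polynomial F) •
    (((k.factorial : F)⁻¹ • X ^ k).map Polynomial.C)

theorem map_eval_pexp {X : Matrix (Fin n) (Fin n) F} (hX : IsNilpotent X) (t : F) :
    (pexp X).map (Polynomial.eval t) = (gexp (t • X) : Matrix (Fin n) (Fin n) F) := by
  rw [coe_gexp (hX.smul t), IsNilpotent.exp_eq_sum (k := nilpotencyClass X)
    (by rw [smul_pow, pow_nilpotencyClass hX, smul_zero])]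
  ext i j
  simp only [pexp, map_apply, Matrix.sum_apply, Polynomial.eval_finsetSum]
  refine Finset.sum_congr rfl fun k _ => ?_
  simp [smul_pow, Rat.smul_def]
  ring

theorem map_derivative_mul (A B : Matrix (Fin n) (Fin n) (Polynomial F)) :
    (A * B).map Polynomial.derivative =
      A.map Polynomial.derivative * B + A * B.map Polynomial.derivative := by
  ext i j : 1
  simp [Matrix.mul_apply, Finset.sum_add_distrib]

theorem map_derivative_pexp {X : Matrix (Fin n) (Fin n) F} (hX : IsNilpotent X) :
    (pexp X).map Polynomial.derivative = X.map Polynomial.C * pexp X := by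
  have h1 : (pexp X).map Polynomial.derivative = ∑ k ∈ Finset.range (nilpotencyClass X),
      (Polynomial.C (k : F) * Polynomial.X ^ (k - 1) : Polynomial F) •
        (((k.factorial : F)⁻¹ • X ^ k).map Polynomial.C) := by
    ext i j : 1
    simp only [pexp, map_apply, Matrix.sum_apply, map_sum]
    refine Finset.sum_congr rfl fun k _ => ?_
    simp [Polynomial.derivative_X_pow]
  rw [h1, pexp, Finset.mul_sum]
  have h2 : ∀ k, X.map Polynomial.C * ((Polynomial.X ^ k : Polynomial F) •
      (((k.factorial : F)⁻¹ • X ^ k).map Polynomial.C)) =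
      (Polynomial.C ((k + 1 : ℕ) : F) * Polynomial.X ^ k : Polynomial F) •
        ((((k + 1).factorial : F)⁻¹ • X ^ (k + 1)).map Polynomial.C) := by
    intro k
    rw [Matrix.mul_smul, mul_comm (Polynomial.C _), mul_smul]
    congr 1
    rw [← Matrix.map_mul (f := Polynomial.C), Matrix.mul_smul, ← pow_succ']
    ext i j : 1
    have : ((k : F) + 1) ≠ 0 := by exact_mod_cast Nat.succ_ne_zero k
    simp only [map_apply, Matrix.smul_apply, smul_eq_mul, ← Polynomial.C_mul]
    congr 1
    rw [Nat.factorial_succ]; push_cast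
    field_simp
  simp only [h2]
  generalize hN : nilpotencyClass X = N
  have hz : X ^ N = 0 := hN ▸ pow_nilpotencyClass hX
  cases N with
  | zero => simp
  | succ N =>
    rw [Finset.sum_range_succ', Finset.sum_range_succ, hz]
    simp

theorem poly_eq_zero_of_eval_nat {p : Polynomial F} (h : ∀ k : ℕ, p.eval (k : F) = 0) : p = 0 :=
  Polynomial.eq_zero_of_infinite_isRoot p
    (Set.infinite_of_injective_forall_mem (f := fun k : ℕ => (k : F))
      (Nat.cast_injective (R := F)) h)

theorem map_eval_zero_derivative_pexp {X : Matrix (Fin n) (Fin n) F} (hX : IsNilpotent X) :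
    ((pexp X).map Polynomial.derivative).map (Polynomial.eval 0) = X := by
  have h : ∀ A B : Matrix (Fin n) (Fin n) (Polynomial F), (A * B).map (Polynomial.eval 0) =
    A.map (Polynomial.eval 0) * B.map (Polynomial.eval 0) := fun A B =>
      Matrix.map_mul (f := Polynomial.evalRingHom (0 : F))
  rw [map_derivative_pexp hX, h, map_eval_pexp hX, zero_smul, gexp_zero, Units.val_one, mul_one]
  ext; simp

theorem pexp_injective {X Y : Matrix (Fin n) (Fin n) F} (hX : IsNilpotent X) (hY : IsNilpotent Y)
    (h : pexp X = pexp Y) : X = Y := by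
  rw [← map_eval_zero_derivative_pexp hX, h, map_eval_zero_derivative_pexp hY]

theorem gexp_injective {X Y : Matrix (Fin n) (Fin n) F} (hX : IsNilpotent X) (hY : IsNilpotent Y)
    (h : gexp X = gexp Y) : X = Y := by
  refine pexp_injective hX hY ?_
  ext i j : 1
  rw [← sub_eq_zero]
  refine poly_eq_zero_of_eval_nat fun k => ?_
  have hx := congrFun₂ (map_eval_pexp hX (k : F)) i j
  have hy := congrFun₂ (map_eval_pexp hY (k : F)) i j
  rw [gexp_nat_smul hX] at hx
  rw [gexp_nat_smul hY, ← h, ← hx] at hy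
  simp only [map_apply] at hy
  rw [Polynomial.eval_sub, hy, sub_self]

theorem eq_aeval_gexp {X : Matrix (Fin n) (Fin n) F} (hX : IsNilpotent X) :
    ∃ q : Polynomial F, X = Polynomial.aeval (gexp X : Matrix (Fin n) (Fin n) F) q := by
  obtain ⟨Y, hY, h, h'⟩ := exists_gexp_eq (isUnipotentElt_gexp hX)
  rwa [gexp_injective hY hX h] at h'

theorem commute_aeval {x y : Matrix (Fin n) (Fin n) F} (h : Commute x y) (q : Polynomial F) :
    Commute x (Polynomial.aeval y q) := by
  induction q using Polynomial.induction_on' with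
  | add p q hp hq => rw [map_add]; exact hp.add_right hq
  | monomial k c =>
    rw [Polynomial.aeval_monomial]
    exact (Algebra.commute_algebraMap_right c x).mul_right (h.pow_right k)

theorem commute_of_commute_gexp {X x : Matrix (Fin n) (Fin n) F} (hX : IsNilpotent X)
    (h : Commute x (gexp X : Matrix (Fin n) (Fin n) F)) : Commute x X := by
  obtain ⟨q, hq⟩ := eq_aeval_gexp hX
  rw [hq]
  exact commute_aeval h q

theorem commute_gexp_of_commute {X x : Matrix (Fin n) (Fin n) F} (hX : IsNilpotent X)
    (h : Commute x X) : Commute x (gexp X : Matrix (Fin n) (Fin n) F) := by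
  rw [coe_gexp hX, IsNilpotent.exp]
  exact Commute.sum_right _ _ _ fun k _ => (h.pow_right k).smul_right _

end ExpLog

section LieAlgebraOfUnipotents

set_option linter.unusedSectionVars false

variable {F : Type} [Field F] [CharZero F] {n : ℕ}

/-- The value of a polynomial in the matrix entries along a polynomial curve of matrices. -/
noncomputable def alongCurve (E : Matrix (Fin n) (Fin n) (Polynomial F)) :
    MvPolynomial (Fin n × Fin n) F →ₐ[F] Polynomial F :=
  MvPolynomial.aeval fun ij => E ij.1 ij.2

/-- Evaluation of polynomials in the matrix entries. -/
noncomputable def evalAt (x : Matrix (Fin n) (Fin n) F) :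
    MvPolynomial (Fin n × Fin n) F →+* F :=
  MvPolynomial.eval fun ij => x ij.1 ij.2

theorem eval_alongCurve (E : Matrix (Fin n) (Fin n) (Polynomial F))
    (p : MvPolynomial (Fin n × Fin n) F) (t : F) :
    (alongCurve E p).eval t = evalAt (E.map (Polynomial.eval t)) p := by
  induction p using MvPolynomial.induction_on with
  | C a => simp [alongCurve, evalAt]
  | add p q hp hq => simp only [map_add, Polynomial.eval_add, hp, hq]
  | mul_X p i hp =>
    simp only [map_mul, Polynomial.eval_mul, hp]
    simp [alongCurve, evalAt]

theorem gexp_smul_mem {D : Subgroup (GL (Fin n) F)} (hD : IsAlgebraicSubgroup F n D)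
    {X : Matrix (Fin n) (Fin n) F} (hX : IsNilpotent X)
    (h : ∀ k : ℕ, gexp ((k : F) • X) ∈ D) (t : F) : gexp (t • X) ∈ D := by
  obtain ⟨S, hS⟩ := hD
  refine (hS _).2 fun p hp => ?_
  have hzero : alongCurve (pexp X) p = 0 := poly_eq_zero_of_eval_nat fun k => by
    rw [eval_alongCurve, map_eval_pexp hX]
    exact (hS _).1 (h k) p hp
  have := eval_alongCurve (pexp X) p t
  rw [hzero, map_eval_pexp hX, Polynomial.eval_zero] at this
  exact this.symm

theorem gexp_smul_mem_of_gexp_mem {D : Subgroup (GL (Fin n) F)} (hD : IsAlgebraicSubgroup F n D)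
    {X : Matrix (Fin n) (Fin n) F} (hX : IsNilpotent X) (h : gexp X ∈ D) (t : F) :
    gexp (t • X) ∈ D :=
  gexp_smul_mem hD hX (fun k => by rw [gexp_nat_smul hX]; exact pow_mem h k) t

theorem isConnectedAlgSubgroup_of_isUnipotentElt {D : Subgroup (GL (Fin n) F)}
    (hD : IsAlgebraicSubgroup F n D) (hu : ∀ d ∈ D, IsUnipotentElt F n d) :
    IsConnectedAlgSubgroup F n D := by
  refine ⟨hD, fun H hH hHD hfin => le_antisymm hHD fun d hd => ?_⟩
  obtain ⟨X, hX, rfl, -⟩ := exists_gexp_eq (hu d hd)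
  obtain ⟨N, hN, hpow⟩ := Subgroup.exists_pow_mem_of_index_ne_zero hfin.index_ne_zero ⟨_, hd⟩
  have hmem : gexp ((N : F) • X) ∈ H := by
    rw [gexp_nat_smul hX]
    simpa [Subgroup.mem_subgroupOf] using hpow.2
  have := gexp_smul_mem_of_gexp_mem hH (hX.smul (N : F)) hmem (N : F)⁻¹
  rwa [smul_smul, inv_mul_cancel₀ (by exact_mod_cast hN.ne'), one_smul] at this

/-- The span of the nilpotent matrices `X` such that `exp (t X)` lies in `D` for all `t`. -/
def lieU (D : Subgroup (GL (Fin n) F)) : Submodule F (Matrix (Fin n) (Fin n) F) :=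
  Submodule.span F {X | IsNilpotent X ∧ ∀ t : F, gexp (t • X) ∈ D}

theorem mem_lieU {D : Subgroup (GL (Fin n) F)} {X : Matrix (Fin n) (Fin n) F}
    (hX : IsNilpotent X) (h : ∀ t : F, gexp (t • X) ∈ D) : X ∈ lieU D :=
  Submodule.subset_span ⟨hX, h⟩

theorem lieU_mono {D D' : Subgroup (GL (Fin n) F)} (h : D ≤ D') : lieU D ≤ lieU D' :=
  Submodule.span_mono fun _ hX => ⟨hX.1, fun t => h (hX.2 t)⟩

theorem conjHom_mem_lieU {D : Subgroup (GL (Fin n) F)} {g : GL (Fin n) F}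
    (hg : ∀ d ∈ D, g * d * g⁻¹ ∈ D) {X : Matrix (Fin n) (Fin n) F} (hX : X ∈ lieU D) :
    conjHom g X ∈ lieU D := by
  have : lieU D ≤ (lieU D).comap (conjHom g).toLinearMap := by
    refine Submodule.span_le.2 fun Y hY => mem_lieU (isNilpotent_conjHom g hY.1) fun t => ?_
    change gexp (t • conjHom g Y) ∈ D
    rw [← map_smul, gexp_conjHom g (hY.1.smul t)]
    exact hg _ (hY.2 t)
  exact this hX

theorem apply_derivative_eq (φ : Matrix (Fin n) (Fin n) F →ₗ[F] F)
    (E : Matrix (Fin n) (Fin n) (Polynomial F)) (p : Polynomial F)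
    (h : ∀ t, φ (E.map (Polynomial.eval t)) = p.eval t) :
    φ ((E.map Polynomial.derivative).map (Polynomial.eval 0)) = p.derivative.eval 0 := by
  have hφ : ∀ M : Matrix (Fin n) (Fin n) F,
      φ M = ∑ i, ∑ j, M i j * φ (Matrix.single i j 1) := by
    intro M
    conv_lhs => rw [Matrix.matrix_eq_sum_single M]
    simp only [map_sum]
    refine Finset.sum_congr rfl fun i _ => Finset.sum_congr rfl fun j _ => ?_
    rw [← smul_eq_mul, ← map_smul, Matrix.smul_single, smul_eq_mul, mul_one]
  have hp : p = ∑ i, ∑ j, E i j * Polynomial.C (φ (Matrix.single i j 1)) := by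
    rw [← sub_eq_zero]
    refine poly_eq_zero_of_eval_nat fun k => ?_
    rw [Polynomial.eval_sub, ← h, hφ, sub_eq_zero]
    simp [Polynomial.eval_finsetSum]
  rw [hφ, hp]
  simp [Polynomial.eval_finsetSum]

theorem derivative_mem {W : Submodule F (Matrix (Fin n) (Fin n) F)}
    {E : Matrix (Fin n) (Fin n) (Polynomial F)}
    (h : ∀ t, E.map (Polynomial.eval t) ∈ W) :
    (E.map Polynomial.derivative).map (Polynomial.eval 0) ∈ W := by
  refine (Subspace.forall_mem_dualAnnihilator_apply_eq_zero_iff W _).1 fun φ hφ => ?_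
  rw [apply_derivative_eq φ E 0 fun t => ?_]
  · simp
  · rw [Polynomial.eval_zero]
    exact (Submodule.mem_dualAnnihilator φ).1 hφ _ (h t)

theorem map_eval_mul (t : F) (A B : Matrix (Fin n) (Fin n) (Polynomial F)) :
    (A * B).map (Polynomial.eval t) = A.map (Polynomial.eval t) * B.map (Polynomial.eval t) :=
  Matrix.map_mul (f := Polynomial.evalRingHom t)

theorem map_C_map_eval (t : F) (A : Matrix (Fin n) (Fin n) F) :
    (A.map Polynomial.C).map (Polynomial.eval t) = A := by
  ext; simp

/-- The polynomial curve `t ↦ exp (t X) Y exp (- t X)`. -/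
noncomputable def conjCurve (X Y : Matrix (Fin n) (Fin n) F) :
    Matrix (Fin n) (Fin n) (Polynomial F) :=
  pexp X * Y.map Polynomial.C * pexp (-X)

theorem map_eval_conjCurve {X : Matrix (Fin n) (Fin n) F} (hX : IsNilpotent X)
    (Y : Matrix (Fin n) (Fin n) F) (t : F) :
    (conjCurve X Y).map (Polynomial.eval t) = conjHom (gexp (t • X)) Y := by
  rw [conjCurve, map_eval_mul, map_eval_mul, map_eval_pexp hX, map_eval_pexp hX.neg,
    map_C_map_eval, conjHom_apply, smul_neg, gexp_neg (hX.smul t)]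

theorem map_derivative_conjCurve {X : Matrix (Fin n) (Fin n) F} (hX : IsNilpotent X)
    (Y : Matrix (Fin n) (Fin n) F) :
    ((conjCurve X Y).map Polynomial.derivative).map (Polynomial.eval 0) = X * Y - Y * X := by
  have h0 : ∀ {X : Matrix (Fin n) (Fin n) F}, IsNilpotent X →
      (pexp X).map (Polynomial.eval 0) = 1 := fun hX => by
    rw [map_eval_pexp hX, zero_smul, gexp_zero, Units.val_one]
  have hadd : ∀ A B : Matrix (Fin n) (Fin n) (Polynomial F), (A + B).map (Polynomial.eval 0) =
      A.map (Polynomial.eval 0) + B.map (Polynomial.eval 0) := fun A B => by ext; simp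
  have hY : (Y.map Polynomial.C).map Polynomial.derivative = 0 := by ext i j : 1; simp
  rw [conjCurve, map_derivative_mul, map_derivative_mul, hY, mul_zero, add_zero, hadd,
    map_eval_mul, map_eval_mul, map_eval_mul, map_eval_mul, map_eval_zero_derivative_pexp hX,
    map_eval_zero_derivative_pexp hX.neg, h0 hX, h0 hX.neg, map_C_map_eval]
  simp [sub_eq_add_neg]

theorem lieU_bracket_mem {D : Subgroup (GL (Fin n) F)} {L : Submodule F (Matrix (Fin n) (Fin n) F)}
    (hL : ∀ g ∈ D, ∀ Y ∈ L, conjHom g Y ∈ L) :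
    ∀ x ∈ lieU D, ∀ y ∈ L, x * y - y * x ∈ L := by
  intro x hx y hy
  have : lieU D ≤ L.comap (LinearMap.mulRight F y - LinearMap.mulLeft F y) := by
    refine Submodule.span_le.2 fun X hX => ?_
    change X * y - y * X ∈ L
    rw [← map_derivative_conjCurve hX.1]
    refine derivative_mem fun t => ?_
    rw [map_eval_conjCurve hX.1]
    exact hL _ (hX.2 t) y hy
  exact this hx

theorem lieU_bracket_mem_self (D : Subgroup (GL (Fin n) F)) :
    ∀ x ∈ lieU D, ∀ y ∈ lieU D, x * y - y * x ∈ lieU D :=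
  lieU_bracket_mem fun _ hg _ hY =>
    conjHom_mem_lieU (fun _ hd => mul_mem (mul_mem hg hd) (inv_mem hg)) hY

/-- The derivation of the polynomial ring in the matrix entries induced by the right-invariant
vector field with value `Y` at `1`. -/
noncomputable def vecField (Y : Matrix (Fin n) (Fin n) F) :
    Derivation F (MvPolynomial (Fin n × Fin n) F) (MvPolynomial (Fin n × Fin n) F) :=
  MvPolynomial.mkDerivation F fun ij =>
    ∑ k, MvPolynomial.C (Y ij.1 k) * MvPolynomial.X (k, ij.2)

theorem derivative_alongCurve {E : Matrix (Fin n) (Fin n) (Polynomial F)}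
    {Y : Matrix (Fin n) (Fin n) F} (hE : E.map Polynomial.derivative = Y.map Polynomial.C * E)
    (p : MvPolynomial (Fin n × Fin n) F) :
    Polynomial.derivative (alongCurve E p) = alongCurve E (vecField Y p) := by
  induction p using MvPolynomial.induction_on with
  | C a => simp [alongCurve, vecField]
  | add p q hp hq => simp only [map_add, hp, hq]
  | mul_X p ij hp =>
    have hX : Polynomial.derivative (alongCurve E (MvPolynomial.X ij)) =
        alongCurve E (vecField Y (MvPolynomial.X ij)) := by
      have := congrFun₂ hE ij.1 ij.2
      simpa [alongCurve, vecField, Matrix.mul_apply] using this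
    rw [map_mul, Polynomial.derivative_mul, hp, hX, Derivation.leibniz]
    simp only [map_add, smul_eq_mul, map_mul]
    ring

theorem vecField_add (Y Z : Matrix (Fin n) (Fin n) F) :
    vecField (Y + Z) = vecField Y + vecField Z := by
  refine MvPolynomial.derivation_ext fun ij => ?_
  simp [vecField, add_mul, Finset.sum_add_distrib]

theorem vecField_smul (c : F) (Y : Matrix (Fin n) (Fin n) F) :
    vecField (c • Y) = c • vecField Y := by
  refine MvPolynomial.derivation_ext fun ij => ?_
  simp [vecField, Finset.smul_sum, MvPolynomial.smul_eq_C_mul, mul_assoc]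

theorem vecField_zero : vecField (0 : Matrix (Fin n) (Fin n) F) = 0 := by
  refine MvPolynomial.derivation_ext fun ij => ?_
  simp [vecField]

theorem evalAt_vecField_eq_zero {D : Subgroup (GL (Fin n) F)} {Y : Matrix (Fin n) (Fin n) F}
    (hY : Y ∈ lieU D) {p : MvPolynomial (Fin n × Fin n) F}
    (hp : ∀ d ∈ D, evalAt (d : Matrix (Fin n) (Fin n) F) p = 0) :
    ∀ d ∈ D, evalAt (d : Matrix (Fin n) (Fin n) F) (vecField Y p) = 0 := by
  intro d hd
  refine Submodule.span_induction ?_ ?_ ?_ ?_ hY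
  · rintro X ⟨hX, hXD⟩
    set E := pexp X * (d : Matrix (Fin n) (Fin n) F).map Polynomial.C with hEdef
    have hE : E.map Polynomial.derivative = X.map Polynomial.C * E := by
      have hd0 : ((d : Matrix (Fin n) (Fin n) F).map Polynomial.C).map Polynomial.derivative =
        0 := by ext i j : 1; simp
      rw [hEdef, map_derivative_mul, hd0, mul_zero, add_zero, map_derivative_pexp hX, mul_assoc]
    have hEt : ∀ t, E.map (Polynomial.eval t) =
        (↑(gexp (t • X) * d) : Matrix (Fin n) (Fin n) F) := fun t => by
      rw [hEdef, map_eval_mul, map_eval_pexp hX, map_C_map_eval, Units.val_mul]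
    have hzero : alongCurve E p = 0 := poly_eq_zero_of_eval_nat fun k => by
      rw [eval_alongCurve, hEt]
      exact hp _ (mul_mem (hXD _) hd)
    have := eval_alongCurve E (vecField X p) 0
    rw [← derivative_alongCurve hE, hzero, hEt, zero_smul, gexp_zero, one_mul] at this
    simpa using this.symm
  · rw [vecField_zero]; simp
  · intro x y _ _ hx hy
    rw [vecField_add, Derivation.add_apply, map_add, hx, hy, add_zero]
  · intro c x _ hx
    rw [vecField_smul, Derivation.smul_apply, MvPolynomial.smul_eq_C_mul, map_mul, hx, mul_zero]

theorem gexp_mem_of_mem_lieU {D : Subgroup (GL (Fin n) F)} (hD : IsAlgebraicSubgroup F n D)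
    {Y : Matrix (Fin n) (Fin n) F} (hY : Y ∈ lieU D) (hn : IsNilpotent Y) : gexp Y ∈ D := by
  obtain ⟨S, hS⟩ := hD
  refine (hS _).2 fun p hp => ?_
  have hiter : ∀ k : ℕ, ∀ d ∈ D,
      evalAt (d : Matrix (Fin n) (Fin n) F) ((vecField Y)^[k] p) = 0 := by
    intro k
    induction k with
    | zero => exact fun d hd => (hS d).1 hd p hp
    | succ k ih =>
      rw [Function.iterate_succ_apply']
      exact evalAt_vecField_eq_zero hY ih
  have hder : ∀ k : ℕ, Polynomial.derivative^[k] (alongCurve (pexp Y) p) =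
      alongCurve (pexp Y) ((vecField Y)^[k] p) := by
    intro k
    induction k with
    | zero => rfl
    | succ k ih =>
      rw [Function.iterate_succ_apply', ih, derivative_alongCurve (map_derivative_pexp hn),
        Function.iterate_succ_apply']
  have hzero : alongCurve (pexp Y) p = 0 := by
    ext k
    have h1 := congrArg (Polynomial.eval 0) (hder k)
    rw [eval_alongCurve, map_eval_pexp hn, zero_smul, gexp_zero, hiter k 1 (one_mem D),
      ← Polynomial.coeff_zero_eq_eval_zero, Polynomial.coeff_iterate_derivative] at h1
    have hk : ((k.factorial : ℕ) : F) ≠ 0 := by exact_mod_cast k.factorial_ne_zero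
    simpa [Nat.descFactorial_self, hk] using h1
  have := eval_alongCurve (pexp Y) p 1
  rw [hzero, map_eval_pexp hn, one_smul, Polynomial.eval_zero] at this
  exact this.symm

end LieAlgebraOfUnipotents

section Jordan

set_option linter.unusedSectionVars false

variable {F : Type} [Field F] [CharZero F] {n : ℕ}

theorem isSemisimpleElt_iff_exists_squarefree {s : GL (Fin n) F} :
    IsSemisimpleElt F n s ↔ ∃ p : Polynomial F, Squarefree p ∧
      Polynomial.aeval (s : Matrix (Fin n) (Fin n) F) p = 0 := by
  have key (p : Polynomial F) : Polynomial.aeval (toLin' (s : Matrix (Fin n) (Fin n) F)) p =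
      toLinAlgEquiv' (Polynomial.aeval (s : Matrix (Fin n) (Fin n) F) p) :=
    Polynomial.aeval_algHom_apply (toLinAlgEquiv' (R := F) (n := Fin n)) _ p
  constructor
  · intro h
    refine ⟨_, h.minpoly_squarefree, ?_⟩
    simp
  · rintro ⟨p, hp, h⟩
    refine Module.End.isSemisimple_of_squarefree_aeval_eq_zero hp ?_
    rw [key, h, map_zero]

theorem isSemisimpleElt_one : IsSemisimpleElt F n 1 :=
  isSemisimpleElt_iff_exists_squarefree.2
    ⟨Polynomial.X - 1, (Polynomial.irreducible_X_sub_C (1 : F)).squarefree, by simp⟩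

theorem IsSemisimpleElt.conj {s : GL (Fin n) F} (h : IsSemisimpleElt F n s) (g : GL (Fin n) F) :
    IsSemisimpleElt F n (g * s * g⁻¹) := by
  obtain ⟨p, hp, h0⟩ := isSemisimpleElt_iff_exists_squarefree.1 h
  refine isSemisimpleElt_iff_exists_squarefree.2 ⟨p, hp, ?_⟩
  have : ((g * s * g⁻¹ : GL (Fin n) F) : Matrix (Fin n) (Fin n) F) = conjHom g s := by
    rw [conjHom_apply]; rfl
  rw [this, Polynomial.aeval_algHom_apply, h0, map_zero]

/-- `g = s * exp X` is the multiplicative Jordan decomposition of `g`. -/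
structure IsJordanDecomp (g s : GL (Fin n) F) (X : Matrix (Fin n) (Fin n) F) : Prop where
  isSemisimpleElt : IsSemisimpleElt F n s
  isNilpotent : IsNilpotent X
  commute : Commute (s : Matrix (Fin n) (Fin n) F) X
  eq_mul : g = s * gexp X

theorem IsJordanDecomp.commute_gexp {g s : GL (Fin n) F} {X : Matrix (Fin n) (Fin n) F}
    (h : IsJordanDecomp g s X) : Commute s (gexp X) :=
  Units.ext (commute_gexp_of_commute h.isNilpotent h.commute).eq

theorem isJordanDecomp_gexp {X : Matrix (Fin n) (Fin n) F} (hX : IsNilpotent X) :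
    IsJordanDecomp (gexp X) 1 X :=
  ⟨isSemisimpleElt_one, hX, Commute.one_left X, (one_mul _).symm⟩

theorem IsJordanDecomp.conj {g s : GL (Fin n) F} {X : Matrix (Fin n) (Fin n) F}
    (h : IsJordanDecomp g s X) (c : GL (Fin n) F) :
    IsJordanDecomp (c * g * c⁻¹) (c * s * c⁻¹) (conjHom c X) where
  isSemisimpleElt := h.isSemisimpleElt.conj c
  isNilpotent := isNilpotent_conjHom c h.isNilpotent
  commute := by
    have : ((c * s * c⁻¹ : GL (Fin n) F) : Matrix (Fin n) (Fin n) F) = conjHom c s := by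
      rw [conjHom_apply]; rfl
    rw [this]
    exact h.commute.map (conjHom c)
  eq_mul := by rw [gexp_conjHom c h.isNilpotent, h.eq_mul]; group

theorem exists_isJordanDecomp (g : GL (Fin n) F) : ∃ s X, IsJordanDecomp g s X := by
  obtain ⟨N, hN, S, hS, hNn, hSs, hg⟩ := Module.End.exists_isNilpotent_isSemisimple
    (f := toLin' (g : Matrix (Fin n) (Fin n) F))
  have hcomm : Commute N S := Algebra.commute_of_mem_adjoin_singleton_of_commute hS
    (Algebra.commute_of_mem_adjoin_self hN).symm
  set φ : Module.End F (Fin n → F) ≃ₐ[F] Matrix (Fin n) (Fin n) F := toLinAlgEquiv'.symm with hφ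
  have hg' : (g : Matrix (Fin n) (Fin n) F) = φ N + φ S := by
    rw [← map_add, ← hg]
    exact (toLinAlgEquiv'.symm_apply_apply (g : Matrix (Fin n) (Fin n) F)).symm
  have hNn' : IsNilpotent (φ N) := hNn.map φ
  have hc : Commute (φ N) (φ S) := hcomm.map φ
  have hSu : IsUnit (φ S) := by
    have : φ S = g + -φ N := by rw [hg']; abel
    rw [this]
    refine hNn'.neg.isUnit_add_left_of_commute g.isUnit ?_
    rw [hg']
    exact ((Commute.refl _).add_right hc).neg_left
  obtain ⟨s, hs⟩ := hSu
  have hcs : Commute (φ N) (s : Matrix (Fin n) (Fin n) F) := hs ▸ hc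
  have hu : ((s⁻¹ * g : GL (Fin n) F) : Matrix (Fin n) (Fin n) F) - 1 =
      (↑s⁻¹ : Matrix (Fin n) (Fin n) F) * φ N := by
    rw [Units.val_mul, hg', ← hs, mul_add, Units.inv_mul]
    abel
  obtain ⟨X, hX, hexp, q, hq⟩ := exists_gexp_eq (u := s⁻¹ * g) (by
    rw [IsUnipotentElt, hu]
    exact (Commute.units_inv_left hcs.symm).isNilpotent_mul_left hNn')
  refine ⟨s, X, ?_, hX, ?_, by rw [hexp, mul_inv_cancel_left]⟩
  · have : toLin' (s : Matrix (Fin n) (Fin n) F) = S := by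
      rw [hs]; exact toLinAlgEquiv'.apply_symm_apply S
    rw [IsSemisimpleElt, this]
    exact hSs
  · rw [hq]
    refine commute_aeval ?_ q
    rw [Units.val_mul, hg', ← hs]
    exact (Commute.units_inv_right (Commute.refl _)).mul_right
      (hcs.symm.add_right (Commute.refl _))

theorem IsJordanDecomp.unique {g s₁ s₂ : GL (Fin n) F} {X₁ X₂ : Matrix (Fin n) (Fin n) F}
    (h₁ : IsJordanDecomp g s₁ X₁) (h₂ : IsJordanDecomp g s₂ X₂) : s₁ = s₂ ∧ X₁ = X₂ := by
  have aux {s : GL (Fin n) F} {X : Matrix (Fin n) (Fin n) F} (h : IsJordanDecomp g s X) :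
      IsNilpotent (toLinAlgEquiv' ((s : Matrix (Fin n) (Fin n) F) *
        ((gexp X : Matrix (Fin n) (Fin n) F) - 1))) ∧
      Commute (toLinAlgEquiv' ((s : Matrix (Fin n) (Fin n) F) *
        ((gexp X : Matrix (Fin n) (Fin n) F) - 1)))
          (toLinAlgEquiv' (s : Matrix (Fin n) (Fin n) F)) ∧
      toLinAlgEquiv' ((s : Matrix (Fin n) (Fin n) F) *
        ((gexp X : Matrix (Fin n) (Fin n) F) - 1)) + toLinAlgEquiv' (s : Matrix (Fin n) (Fin n) F)
        = toLinAlgEquiv' (g : Matrix (Fin n) (Fin n) F) := by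
    have hc : Commute (s : Matrix (Fin n) (Fin n) F) ((gexp X : Matrix (Fin n) (Fin n) F) - 1) :=
      (commute_gexp_of_commute h.isNilpotent h.commute).sub_right (Commute.one_right _)
    refine ⟨(hc.isNilpotent_mul_left (isUnipotentElt_gexp h.isNilpotent)).map _,
      (((Commute.refl _).mul_right hc).symm).map toLinAlgEquiv', ?_⟩
    rw [← map_add, h.eq_mul, mul_sub, mul_one, sub_add_cancel, Units.val_mul]
  obtain ⟨hn₁, hc₁, he₁⟩ := aux h₁
  obtain ⟨hn₂, hc₂, he₂⟩ := aux h₂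
  have hs := (Module.End.isNilpotent_isSemisimple_unique hn₁ h₁.isSemisimpleElt hn₂
    h₂.isSemisimpleElt hc₁ hc₂ (he₁.trans he₂.symm)).2
  have hs' : s₁ = s₂ := Units.ext (toLinAlgEquiv'.injective hs)
  subst hs'
  exact ⟨rfl, gexp_injective h₁.isNilpotent h₂.isNilpotent
    (mul_left_cancel (h₁.eq_mul.symm.trans h₂.eq_mul))⟩

theorem IsJordanDecomp.commute_of_commute {g s c : GL (Fin n) F} {X : Matrix (Fin n) (Fin n) F}
    (h : IsJordanDecomp g s X) (hc : Commute c g) : Commute c s := by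
  have h' := h.conj c
  rw [hc.eq, mul_inv_cancel_right] at h'
  exact mul_inv_eq_iff_eq_mul.1 (h'.unique h).1

end Jordan

section ExponentialPolynomials

set_option linter.unusedSectionVars false

/-- The value at `(k, t)` of the exponential polynomial `∑ c_μ(t) μ ^ k`. -/
noncomputable def expPolyEval {K : Type} [Field K] (k : ℕ) (t : K) :
    MonoidAlgebra (Polynomial K) Kˣ →+* K :=
  MonoidAlgebra.liftNCRingHom (Polynomial.evalRingHom t)
    ((Units.coeHom K).comp (powMonoidHom k)) fun _ _ => Commute.all _ _

theorem expPolyEval_single {K : Type} [Field K] (k : ℕ) (t : K) (μ : Kˣ) (c : Polynomial K) :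
    expPolyEval k t (MonoidAlgebra.single μ c) = c.eval t * (μ : K) ^ k := by
  simp [expPolyEval]

theorem expPolyEval_eq_sum {K : Type} [Field K] (k : ℕ) (t : K)
    (x : MonoidAlgebra (Polynomial K) Kˣ) :
    expPolyEval k t x = ∑ μ ∈ x.coeff.support, (x.coeff μ).eval t * (μ : K) ^ k := by
  conv_lhs => rw [← MonoidAlgebra.sum_coeff_single x]
  simp only [Finsupp.sum, map_sum, expPolyEval_single]

theorem shift_sub_smul_pow {K : Type} [Field K] (μ : K) (e : K → K) (j : ℕ) :
    ((LinearMap.funLeft K K (· + 1 : ℕ → ℕ) - μ • 1) ^ j) (fun k : ℕ => e k * μ ^ k) =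
      fun k : ℕ => (fwdDiff 1)^[j] e k * μ ^ (k + j) := by
  induction j generalizing e with
  | zero => simp
  | succ j ih =>
    rw [pow_succ, Module.End.mul_apply]
    have : (LinearMap.funLeft K K (· + 1 : ℕ → ℕ) - μ • 1) (fun k : ℕ => e k * μ ^ k) =
        μ • fun k : ℕ => fwdDiff 1 e k * μ ^ k := by
      ext k
      simp [LinearMap.funLeft_apply, fwdDiff]
      ring
    rw [this, map_smul, ih, Function.iterate_succ_apply]
    ext k
    simp
    ring

theorem expPolyEval_diagonal_injective {K : Type} [Field K] [CharZero K]
    {x : MonoidAlgebra (Polynomial K) Kˣ} (h : ∀ k : ℕ, expPolyEval k (k : K) x = 0) : x = 0 := by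
  set T : Module.End K (ℕ → K) := LinearMap.funLeft K K (· + 1 : ℕ → ℕ) with hT
  have hind : iSupIndep fun μ : Kˣ => T.maxGenEigenspace (μ : K) :=
    T.independent_maxGenEigenspace.comp Units.val_injective
  have hv := (iSupIndep_iff_finsetSum_eq_zero_imp_eq_zero _).1 hind x.coeff.support
    (fun μ k => (x.coeff μ).eval (k : K) * (μ : K) ^ k) (fun μ _ => by
      refine (T.mem_maxGenEigenspace _ _).2 ⟨(x.coeff μ).natDegree + 1, ?_⟩
      rw [hT, shift_sub_smul_pow (μ : K) (fun t => (x.coeff μ).eval t),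
        Polynomial.fwdDiff_iter_degree_add_one_eq_zero]
      ext; simp) (by
      ext k
      simpa [expPolyEval_eq_sum] using h k)
  ext μ : 2
  by_cases hμ : μ ∈ x.coeff.support
  · refine poly_eq_zero_of_eval_nat fun k => ?_
    have := congrFun (hv μ hμ) k
    simpa using this
  · simpa using hμ

variable {F : Type} [Field F] [CharZero F] {n : ℕ}

/-- The functions `a k t` of `k : ℕ` and `t : F` of the form `∑ c_μ(t) μ ^ k`. -/
def IsExpPoly (a : ℕ → F → F) : Prop :=
  ∃ x : MonoidAlgebra (Polynomial (AlgebraicClosure F)) (AlgebraicClosure F)ˣ,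
    ∀ k t, expPolyEval k (algebraMap F _ t) x = algebraMap F _ (a k t)

theorem IsExpPoly.eq_zero {a : ℕ → F → F} (ha : IsExpPoly a) (h : ∀ k : ℕ, a k k = 0)
    (k : ℕ) (t : F) : a k t = 0 := by
  obtain ⟨x, hx⟩ := ha
  have : x = 0 := expPolyEval_diagonal_injective fun k => by
    have := hx k k
    rwa [h, map_zero, map_natCast] at this
  have := hx k t
  rw [‹x = 0›, map_zero] at this
  exact (algebraMap F (AlgebraicClosure F)).injective (this.symm.trans (map_zero _).symm)

theorem IsExpPoly.add {a b : ℕ → F → F} (ha : IsExpPoly a) (hb : IsExpPoly b) :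
    IsExpPoly fun k t => a k t + b k t := by
  obtain ⟨x, hx⟩ := ha
  obtain ⟨y, hy⟩ := hb
  exact ⟨x + y, fun k t => by rw [map_add, map_add, hx, hy]⟩

theorem IsExpPoly.mul {a b : ℕ → F → F} (ha : IsExpPoly a) (hb : IsExpPoly b) :
    IsExpPoly fun k t => a k t * b k t := by
  obtain ⟨x, hx⟩ := ha
  obtain ⟨y, hy⟩ := hb
  exact ⟨x * y, fun k t => by rw [map_mul, map_mul, hx, hy]⟩

theorem isExpPoly_polynomial (p : Polynomial F) : IsExpPoly fun _ t => p.eval t :=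
  ⟨MonoidAlgebra.single 1 (p.map (algebraMap F _)), fun k t => by
    simp [expPolyEval_single, Polynomial.eval_map_algebraMap, Polynomial.aeval_algebraMap_apply]⟩

theorem isExpPoly_const (c : F) : IsExpPoly fun _ _ => c := by
  simpa using isExpPoly_polynomial (Polynomial.C c)

theorem isExpPoly_pow {c : F} (hc : c ≠ 0) : IsExpPoly fun k _ => c ^ k :=
  ⟨MonoidAlgebra.single (Units.mk0 (algebraMap F _ c) (by simpa using hc)) 1, fun k t => by
    simp [expPolyEval_single]⟩

theorem isExpPoly_eval {σ : Type} {a : σ → ℕ → F → F} (ha : ∀ i, IsExpPoly (a i))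
    (p : MvPolynomial σ F) : IsExpPoly fun k t => MvPolynomial.eval (fun i => a i k t) p := by
  induction p using MvPolynomial.induction_on with
  | C c => simpa using isExpPoly_const c
  | add p q hp hq => simpa using hp.add hq
  | mul_X p i hp => simpa using hp.mul (ha i)

theorem isExpPoly_sum {ι : Type} (s : Finset ι) {a : ι → ℕ → F → F} (ha : ∀ i, IsExpPoly (a i)) :
    IsExpPoly fun k t => ∑ i ∈ s, a i k t := by
  have := isExpPoly_eval ha (∑ i ∈ s, MvPolynomial.X i)
  simpa using this

theorem isExpPoly_matrix_mul {A B : ℕ → F → Matrix (Fin n) (Fin n) F}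
    (hA : ∀ i j, IsExpPoly fun k t => A k t i j) (hB : ∀ i j, IsExpPoly fun k t => B k t i j)
    (i j : Fin n) : IsExpPoly fun k t => (A k t * B k t) i j := by
  simp only [Matrix.mul_apply]
  exact isExpPoly_sum _ fun l => (hA i l).mul (hB l j)

theorem isExpPoly_gexp {X : Matrix (Fin n) (Fin n) F} (hX : IsNilpotent X) (i j : Fin n) :
    IsExpPoly fun _ t => (gexp (t • X) : Matrix (Fin n) (Fin n) F) i j := by
  simp only [← map_eval_pexp hX, Matrix.map_apply]
  exact isExpPoly_polynomial _

end ExponentialPolynomials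

section JordanMembership

set_option linter.unusedSectionVars false

variable {F : Type} [Field F] [CharZero F] {n : ℕ}

theorem exists_squarefree_coeff_zero_ne_zero {s : GL (Fin n) F} (hs : IsSemisimpleElt F n s) :
    ∃ p : Polynomial F, Squarefree p ∧ p.coeff 0 ≠ 0 ∧
      Polynomial.aeval (s : Matrix (Fin n) (Fin n) F) p = 0 := by
  obtain ⟨p, hp, h0⟩ := isSemisimpleElt_iff_exists_squarefree.1 hs
  by_cases hc : p.coeff 0 = 0
  · obtain ⟨r, rfl⟩ := Polynomial.X_dvd_iff.2 hc
    refine ⟨r, hp.squarefree_of_dvd (dvd_mul_left _ _), fun hr => ?_, ?_⟩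
    · obtain ⟨r', rfl⟩ := Polynomial.X_dvd_iff.2 hr
      exact Polynomial.not_isUnit_X (hp Polynomial.X ⟨r', by ring⟩)
    · rw [map_mul, Polynomial.aeval_X] at h0
      exact s.isUnit.mul_right_eq_zero.1 h0
  · exact ⟨p, hp, hc, h0⟩

theorem isExpPoly_pow_of_isSemisimpleElt {s : GL (Fin n) F} (hs : IsSemisimpleElt F n s)
    (i j : Fin n) :
    IsExpPoly fun k _ => ((s ^ k : GL (Fin n) F) : Matrix (Fin n) (Fin n) F) i j := by
  classical
  obtain ⟨p, hp, hc, h0⟩ := exists_squarefree_coeff_zero_ne_zero hs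
  set K := AlgebraicClosure F with hK
  set sK : Matrix (Fin n) (Fin n) K := (algebraMap F K).mapMatrix s with hsK
  have hpK : (p.map (algebraMap F K)) ≠ 0 :=
    (Polynomial.map_ne_zero_iff (algebraMap F K).injective).2 hp.ne_zero
  have hsep : (p.map (algebraMap F K)).Separable :=
    (PerfectField.separable_iff_squarefree.2 hp).map
  have hkill : Polynomial.aeval sK (p.map (algebraMap F K)) = 0 := by
    have h1 : Polynomial.aeval ((Algebra.ofId F K).mapMatrix (s : Matrix (Fin n) (Fin n) F)) p =
        (Algebra.ofId F K).mapMatrix (Polynomial.aeval (s : Matrix (Fin n) (Fin n) F) p) :=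
      Polynomial.aeval_algHom_apply _ _ p
    rw [Polynomial.aeval_map_algebraMap, hsK]
    refine h1.trans ?_
    rw [h0, map_zero]
  set R := (p.map (algebraMap F K)).roots.toFinset with hR
  have hR0 : ∀ μ ∈ R, μ ≠ 0 := by
    rintro μ hμ rfl
    rw [hR, Multiset.mem_toFinset, Polynomial.mem_roots hpK, Polynomial.IsRoot,
      ← Polynomial.coeff_zero_eq_eval_zero, Polynomial.coeff_map] at hμ
    exact hc ((map_eq_zero _).1 hμ)
  have hpow (k : ℕ) : sK ^ k = ∑ μ ∈ R, μ ^ k • Polynomial.aeval sK (Lagrange.basis R id μ) := by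
    have hdvd : p.map (algebraMap F K) ∣
        Polynomial.X ^ k - Lagrange.interpolate R id (fun μ => μ ^ k) := by
      by_cases hz : Polynomial.X ^ k - Lagrange.interpolate R id (fun μ => μ ^ k) = 0
      · rw [hz]; exact dvd_zero _
      refine (IsAlgClosed.splits _).dvd_of_roots_le_roots hpK
        ((Multiset.le_iff_subset (Polynomial.nodup_roots hsep)).2 fun μ hμ => ?_)
      have h := Lagrange.eval_interpolate_at_node (fun μ : K => μ ^ k)
        (Set.injOn_id (R : Set K)) (Multiset.mem_toFinset.2 hμ)
      rw [Polynomial.mem_roots hz, Polynomial.IsRoot, Polynomial.eval_sub, Polynomial.eval_pow,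
        Polynomial.eval_X]
      exact sub_eq_zero.2 h.symm
    obtain ⟨r, hr⟩ := hdvd
    have := congrArg (Polynomial.aeval sK) hr
    rw [map_mul, hkill, zero_mul, map_sub, map_pow, Polynomial.aeval_X, sub_eq_zero,
      Lagrange.interpolate_apply, map_sum] at this
    rw [this]
    refine Finset.sum_congr rfl fun μ _ => ?_
    rw [map_mul, Polynomial.aeval_C, Algebra.smul_def]
  refine ⟨∑ μ ∈ R, if h : μ ≠ 0 then MonoidAlgebra.single (Units.mk0 μ h)
    (Polynomial.C (Polynomial.aeval sK (Lagrange.basis R id μ) i j)) else 0, fun k t => ?_⟩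
  have hk : algebraMap F K (((s ^ k : GL (Fin n) F) : Matrix (Fin n) (Fin n) F) i j) =
      (sK ^ k) i j := by
    rw [hsK, ← map_pow]; simp
  rw [hk, hpow, map_sum, Matrix.sum_apply]
  refine Finset.sum_congr rfl fun μ hμ => ?_
  rw [dif_pos (hR0 μ hμ), expPolyEval_single, Polynomial.eval_C, Units.val_mk0, Matrix.smul_apply,
    smul_eq_mul, mul_comm]

theorem IsJordanDecomp.pow_mul_gexp {g s : GL (Fin n) F} {X : Matrix (Fin n) (Fin n) F}
    (h : IsJordanDecomp g s X) (k : ℕ) : s ^ k * gexp ((k : F) • X) = g ^ k := by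
  rw [gexp_nat_smul h.isNilpotent, h.eq_mul, h.commute_gexp.mul_pow]

theorem IsJordanDecomp.isExpPoly {g s : GL (Fin n) F} {X : Matrix (Fin n) (Fin n) F}
    (h : IsJordanDecomp g s X) (i j : Fin n) :
    IsExpPoly fun k t =>
      ((s ^ k * gexp (t • X) : GL (Fin n) F) : Matrix (Fin n) (Fin n) F) i j := by
  simp only [Units.val_mul]
  refine isExpPoly_matrix_mul (A := fun k _ => (s ^ k : GL (Fin n) F).val)
    (B := fun _ t => (gexp (t • X)).val) ?_ ?_ i j
  · exact isExpPoly_pow_of_isSemisimpleElt h.isSemisimpleElt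
  · exact isExpPoly_gexp h.isNilpotent

theorem IsJordanDecomp.gexp_smul_mem {G : Subgroup (GL (Fin n) F)} (hG : IsAlgebraicSubgroup F n G)
    {g s : GL (Fin n) F} {X : Matrix (Fin n) (Fin n) F} (h : IsJordanDecomp g s X) (hg : g ∈ G)
    (t : F) : gexp (t • X) ∈ G := by
  obtain ⟨S, hS⟩ := hG
  refine (hS _).2 fun p hp => ?_
  have := (isExpPoly_eval (fun ij : Fin n × Fin n => h.isExpPoly ij.1 ij.2) p).eq_zero
    (fun k => (hS _).1 (by rw [h.pow_mul_gexp]; exact pow_mem hg k) p hp) 0 t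
  simpa using this

theorem IsJordanDecomp.gexp_mem {G : Subgroup (GL (Fin n) F)} (hG : IsAlgebraicSubgroup F n G)
    {g s : GL (Fin n) F} {X : Matrix (Fin n) (Fin n) F} (h : IsJordanDecomp g s X) (hg : g ∈ G) :
    gexp X ∈ G := by
  simpa using h.gexp_smul_mem hG hg 1

theorem IsJordanDecomp.mem_lieU {G : Subgroup (GL (Fin n) F)} (hG : IsAlgebraicSubgroup F n G)
    {g s : GL (Fin n) F} {X : Matrix (Fin n) (Fin n) F} (h : IsJordanDecomp g s X) (hg : g ∈ G) :
    X ∈ lieU G :=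
  _root_.mem_lieU h.isNilpotent (h.gexp_smul_mem hG hg)

theorem det_gexp {X : Matrix (Fin n) (Fin n) F} (hX : IsNilpotent X) :
    (gexp X : Matrix (Fin n) (Fin n) F).det = 1 := by
  have heval {X : Matrix (Fin n) (Fin n) F} (hX : IsNilpotent X) (t : F) :
      (pexp X).det.eval t = (gexp (t • X) : Matrix (Fin n) (Fin n) F).det := by
    rw [← map_eval_pexp hX]
    exact (Polynomial.evalRingHom t).map_det (pexp X)
  have hmul : (pexp X).det * (pexp (-X)).det = 1 := Polynomial.funext fun t => by
    rw [Polynomial.eval_mul, heval hX, heval hX.neg, ← Matrix.det_mul, ← Units.val_mul, smul_neg,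
      gexp_neg (hX.smul t), mul_inv_cancel]
    simp
  obtain ⟨c, -, hc⟩ := Polynomial.isUnit_iff.1 (IsUnit.of_mul_eq_one _ hmul)
  have h0 := heval hX 0
  have h1 := heval hX 1
  rw [← hc, Polynomial.eval_C] at h0 h1
  rw [← one_smul F X, ← h1, h0, zero_smul, gexp_zero, Units.val_one, Matrix.det_one]

end JordanMembership

section Differential

set_option linter.unusedSectionVars false

variable {F : Type} [Field F] [CharZero F] {n m : ℕ}

/-- The point of `GL n` given by the matrix entries and the inverse determinant. -/
noncomputable def glPoint (g : GL (Fin n) F) : (Fin n × Fin n) ⊕ Unit → F :=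
  Sum.elim (fun kl => (g : Matrix (Fin n) (Fin n) F) kl.1 kl.2)
    (fun _ => ((g : Matrix (Fin n) (Fin n) F)).det⁻¹)

/-- The homomorphism `f` is given by the polynomials `P`. -/
def IsGivenBy {G : Subgroup (GL (Fin n) F)} (f : ↥G →* GL (Fin m) F)
    (P : Fin m × Fin m → MvPolynomial ((Fin n × Fin n) ⊕ Unit) F) : Prop :=
  ∀ (g : ↥G) (i j : Fin m),
    (f g : Matrix (Fin m) (Fin m) F) i j = MvPolynomial.eval (glPoint (g : GL (Fin n) F)) (P (i, j))

/-- The differential at the identity of the polynomial map `P`, restricted to matrices of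
trace zero. -/
noncomputable def diffAtOne (P : Fin m × Fin m → MvPolynomial ((Fin n × Fin n) ⊕ Unit) F) :
    Matrix (Fin n) (Fin n) F →ₗ[F] Matrix (Fin m) (Fin m) F where
  toFun X := .of fun i j => ∑ kl : Fin n × Fin n,
    MvPolynomial.eval (glPoint 1) (MvPolynomial.pderiv (.inl kl) (P (i, j))) * X kl.1 kl.2
  map_add' X Y := by ext; simp [mul_add, Finset.sum_add_distrib]
  map_smul' c X := by ext; simp [Finset.mul_sum, mul_left_comm]

variable {G : Subgroup (GL (Fin n) F)} {f : ↥G →* GL (Fin m) F}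
  {P : Fin m × Fin m → MvPolynomial ((Fin n × Fin n) ⊕ Unit) F}

theorem IsGivenBy.apply_gexp (hP : IsGivenBy f P) {g : ↥G} {s : GL (Fin n) F}
    {X : Matrix (Fin n) (Fin n) F} (h : IsJordanDecomp (g : GL (Fin n) F) s X)
    {s' : GL (Fin m) F} {X' : Matrix (Fin m) (Fin m) F} (h' : IsJordanDecomp (f g) s' X') (t : F)
    (ht : gexp (t • X) ∈ G) : f ⟨gexp (t • X), ht⟩ = gexp (t • X') := by
  ext i j
  rw [hP]
  have hpoint (kl) : IsExpPoly fun k t => glPoint (s ^ k * gexp (t • X)) kl := by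
    rcases kl with kl | u
    · exact h.isExpPoly kl.1 kl.2
    · have (k : ℕ) (t : F) : glPoint (s ^ k * gexp (t • X)) (.inr u) =
          ((s : Matrix (Fin n) (Fin n) F).det⁻¹) ^ k := by
        simp [glPoint, det_gexp (h.isNilpotent.smul t)]
      simp only [this]
      exact isExpPoly_pow (inv_ne_zero (Matrix.isUnits_det_units s).ne_zero)
  have key := ((isExpPoly_eval hpoint (P (i, j))).add
    ((isExpPoly_const (-1)).mul (h'.isExpPoly i j))).eq_zero (fun k => by
      rw [h.pow_mul_gexp, h'.pow_mul_gexp, ← map_pow, hP]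
      simp) 0 t
  simp only [pow_zero, one_mul] at key
  linear_combination key

theorem IsGivenBy.exists_curve (hP : IsGivenBy f P) {X : Matrix (Fin n) (Fin n) F}
    (hX : IsNilpotent X) : ∃ E : Matrix (Fin m) (Fin m) (Polynomial F),
      (∀ t (ht : gexp (t • X) ∈ G), E.map (Polynomial.eval t) = f ⟨gexp (t • X), ht⟩) ∧
      (E.map Polynomial.derivative).map (Polynomial.eval 0) = diffAtOne P X := by
  set c : (Fin n × Fin n) ⊕ Unit → Polynomial F :=
    Sum.elim (fun kl => pexp X kl.1 kl.2) (fun _ => 1) with hc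
  have hpt (t : F) (v) : (c v).eval t = glPoint (gexp (t • X)) v := by
    rcases v with kl | u
    · simp [hc, glPoint, ← map_eval_pexp hX]
    · simp [hc, glPoint, det_gexp (hX.smul t)]
  have heval (t : F) (p : MvPolynomial ((Fin n × Fin n) ⊕ Unit) F) :
      (MvPolynomial.aeval c p).eval t = MvPolynomial.eval (glPoint (gexp (t • X))) p := by
    induction p using MvPolynomial.induction_on with
    | C a => simp
    | add p q hp hq => simp only [map_add, Polynomial.eval_add, hp, hq]
    | mul_X p i hp => simp [hp, hpt]
  have hder (p : MvPolynomial ((Fin n × Fin n) ⊕ Unit) F) :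
      (MvPolynomial.aeval c p).derivative.eval 0 = ∑ kl : Fin n × Fin n,
        MvPolynomial.eval (glPoint 1) (MvPolynomial.pderiv (.inl kl) p) * X kl.1 kl.2 := by
    have h0 (p : MvPolynomial ((Fin n × Fin n) ⊕ Unit) F) :
        (MvPolynomial.aeval c p).eval 0 = MvPolynomial.eval (glPoint 1) p := by
      rw [heval, zero_smul, gexp_zero]
    have hX' (kl : Fin n × Fin n) : (c (.inl kl)).derivative.eval 0 = X kl.1 kl.2 := by
      rw [← map_eval_zero_derivative_pexp hX]; rfl
    induction p using MvPolynomial.induction_on with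
    | C a => simp
    | add p q hp hq => simp only [map_add, Polynomial.eval_add, hp, hq, add_mul,
        Finset.sum_add_distrib]
    | mul_X p i hp =>
      rw [map_mul, Polynomial.derivative_mul, Polynomial.eval_add, Polynomial.eval_mul,
        Polynomial.eval_mul, hp, h0, MvPolynomial.aeval_X, ← MvPolynomial.aeval_X (R := F) c i, h0,
        MvPolynomial.aeval_X]
      simp only [MvPolynomial.pderiv_mul, map_add, map_mul, add_mul, Finset.sum_add_distrib]
      congr 1
      · rw [Finset.sum_mul]
        exact Finset.sum_congr rfl fun _ _ => by ring
      · rcases i with kl | u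
        · rw [hX', Finset.sum_eq_single kl]
          · simp
          · intro b _ hb
            rw [MvPolynomial.pderiv_X_of_ne (by simpa using hb.symm)]
            simp
          · simp
        · simp [hc]
  refine ⟨.of fun i j => MvPolynomial.aeval c (P (i, j)), fun t ht => ?_, ?_⟩
  · ext i j
    rw [hP]
    exact heval t _
  · ext i j
    exact hder _

theorem IsGivenBy.isNilpotent_and_apply_gexp (hP : IsGivenBy f P) {X : Matrix (Fin n) (Fin n) F}
    (hX : IsNilpotent X) (hG : ∀ t : F, gexp (t • X) ∈ G) :
    IsNilpotent (diffAtOne P X) ∧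
      ∀ t, f ⟨gexp (t • X), hG t⟩ = gexp (t • diffAtOne P X) := by
  obtain ⟨s', X', h'⟩ := exists_isJordanDecomp (f ⟨gexp X, by simpa using hG 1⟩)
  have happ (t : F) := hP.apply_gexp (isJordanDecomp_gexp hX) h' t (hG t)
  obtain ⟨E, hE, hEd⟩ := hP.exists_curve hX
  have : E = pexp X' := by
    ext i j : 1
    refine Polynomial.funext fun t => ?_
    have := (hE t (hG t)).trans (congrArg Units.val (happ t))
    rw [← map_eval_pexp h'.isNilpotent] at this
    exact congrFun (congrFun this i) j
  rw [this, map_eval_zero_derivative_pexp h'.isNilpotent] at hEd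
  rw [← hEd]
  exact ⟨h'.isNilpotent, happ⟩

theorem IsGivenBy.diffAtOne_eq (hP : IsGivenBy f P) (hG : IsAlgebraicSubgroup F n G) {g : ↥G}
    {s : GL (Fin n) F} {X : Matrix (Fin n) (Fin n) F}
    (h : IsJordanDecomp (g : GL (Fin n) F) s X)
    {s' : GL (Fin m) F} {X' : Matrix (Fin m) (Fin m) F} (h' : IsJordanDecomp (f g) s' X') :
    diffAtOne P X = X' := by
  have hmem := h.gexp_smul_mem hG g.2
  obtain ⟨hn, happ⟩ := hP.isNilpotent_and_apply_gexp h.isNilpotent hmem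
  refine gexp_injective hn h'.isNilpotent ?_
  have := (happ 1).symm.trans (hP.apply_gexp h h' 1 (hmem 1))
  simpa using this

theorem IsGivenBy.diffAtOne_conjHom (hP : IsGivenBy f P) (g : ↥G) {X : Matrix (Fin n) (Fin n) F}
    (hX : IsNilpotent X) (hG : ∀ t : F, gexp (t • X) ∈ G) :
    diffAtOne P (conjHom (g : GL (Fin n) F) X) = conjHom (f g) (diffAtOne P X) := by
  obtain ⟨hn, happ⟩ := hP.isNilpotent_and_apply_gexp hX hG
  have hc := isNilpotent_conjHom (g : GL (Fin n) F) hX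
  have hcG (t : F) : gexp (t • conjHom (g : GL (Fin n) F) X) =
      g * gexp (t • X) * (g : GL (Fin n) F)⁻¹ := by
    rw [← map_smul, gexp_conjHom _ (hX.smul t)]
  obtain ⟨hn', happ'⟩ := hP.isNilpotent_and_apply_gexp hc fun t => by
    rw [hcG]; exact mul_mem (mul_mem g.2 (hG t)) (inv_mem g.2)
  refine gexp_injective hn' (isNilpotent_conjHom _ hn) ?_
  have h1 := happ' 1
  have h2 := happ 1
  simp only [one_smul] at h1 h2
  rw [← h1, gexp_conjHom _ hn, ← h2, ← map_inv, ← map_mul, ← map_mul]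
  congr 1
  refine Subtype.ext ?_
  simpa only [one_smul] using! hcG 1

theorem IsGivenBy.diffAtOne_bracket (hP : IsGivenBy f P) {X Y : Matrix (Fin n) (Fin n) F}
    (hX : X ∈ lieU G) (hY : Y ∈ lieU G) :
    diffAtOne P (X * Y - Y * X) =
      diffAtOne P X * diffAtOne P Y - diffAtOne P Y * diffAtOne P X := by
  set δ := diffAtOne P with hδ
  have gen {X Y : Matrix (Fin n) (Fin n) F} (hX : IsNilpotent X)
      (hXG : ∀ t : F, gexp (t • X) ∈ G) (hY : IsNilpotent Y) (hYG : ∀ t : F, gexp (t • Y) ∈ G) :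
      δ (X * Y - Y * X) = δ X * δ Y - δ Y * δ X := by
    obtain ⟨hn, happ⟩ := hP.isNilpotent_and_apply_gexp hX hXG
    ext i j
    rw [← map_derivative_conjCurve hX, ← map_derivative_conjCurve hn]
    exact apply_derivative_eq
      ((LinearMap.proj j ∘ₗ LinearMap.proj i : Matrix (Fin m) (Fin m) F →ₗ[F] F) ∘ₗ δ)
      (conjCurve X Y) (conjCurve (δ X) (δ Y) i j) fun t => by
        change δ ((conjCurve X Y).map (Polynomial.eval t)) i j =
          ((conjCurve (δ X) (δ Y)).map (Polynomial.eval t)) i j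
        rw [map_eval_conjCurve hX, map_eval_conjCurve hn,
          hP.diffAtOne_conjHom ⟨_, hXG t⟩ hY hYG, happ]
  induction hX using Submodule.span_induction with
  | mem X hX =>
    induction hY using Submodule.span_induction with
    | mem Y hY => exact gen hX.1 hX.2 hY.1 hY.2
    | zero => simp
    | add a b _ _ ha hb =>
      rw [show X * (a + b) - (a + b) * X = (X * a - a * X) + (X * b - b * X) by noncomm_ring,
        map_add, ha, hb, map_add]
      noncomm_ring
    | smul c a _ ha =>
      rw [mul_smul_comm, smul_mul_assoc, ← smul_sub, map_smul, ha, map_smul, mul_smul_comm,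
        smul_mul_assoc, smul_sub]
  | zero => simp
  | add a b _ _ ha hb =>
    rw [show (a + b) * Y - Y * (a + b) = (a * Y - Y * a) + (b * Y - Y * b) by noncomm_ring,
      map_add, ha, hb, map_add]
    noncomm_ring
  | smul c a _ ha =>
    rw [mul_smul_comm, smul_mul_assoc, ← smul_sub, map_smul, ha, map_smul, mul_smul_comm,
      smul_mul_assoc, smul_sub]

end Differential

section TraceRadical

set_option linter.unusedSectionVars false

variable {F : Type} [Field F] {n : ℕ}

theorem IsAlgebraicSubgroup.inf {D D' : Subgroup (GL (Fin n) F)} (hD : IsAlgebraicSubgroup F n D)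
    (hD' : IsAlgebraicSubgroup F n D') : IsAlgebraicSubgroup F n (D ⊓ D') := by
  obtain ⟨S, hS⟩ := hD
  obtain ⟨S', hS'⟩ := hD'
  refine ⟨S ∪ S', fun g => ?_⟩
  rw [Subgroup.mem_inf, hS, hS']
  simp only [Set.mem_union, or_imp, forall_and]

theorem isAlgebraicSubgroup_centralizer (U : Set (GL (Fin n) F)) :
    IsAlgebraicSubgroup F n (Subgroup.centralizer U) := by
  refine ⟨{p | ∃ u ∈ U, ∃ i j, p = ∑ k, MvPolynomial.C ((u : Matrix (Fin n) (Fin n) F) i k) *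
    MvPolynomial.X (k, j) - ∑ k, MvPolynomial.X (i, k) *
    MvPolynomial.C ((u : Matrix (Fin n) (Fin n) F) k j)}, fun g => ?_⟩
  rw [Subgroup.mem_centralizer_iff]
  constructor
  · rintro h p ⟨u, hu, i, j, rfl⟩
    have := congrArg (fun x : GL (Fin n) F => (x : Matrix (Fin n) (Fin n) F) i j) (h u hu)
    simp only [Units.val_mul, Matrix.mul_apply] at this
    simpa [sub_eq_zero] using this
  · intro h u hu
    ext i j
    have := h _ ⟨u, hu, i, j, rfl⟩
    rw [Units.val_mul, Units.val_mul, Matrix.mul_apply, Matrix.mul_apply]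
    simpa [sub_eq_zero] using this

/-- The elements of `D` acting trivially for the trace form on the span of `D`. -/
def trRad (D : Subgroup (GL (Fin n) F)) : Subgroup (GL (Fin n) F) where
  carrier := {d | d ∈ D ∧ ∀ d' ∈ D, ((d * d' : GL (Fin n) F) : Matrix (Fin n) (Fin n) F).trace =
    (d' : Matrix (Fin n) (Fin n) F).trace}
  mul_mem' {a b} ha hb := ⟨mul_mem ha.1 hb.1, fun d hd => by
    rw [mul_assoc, ha.2 _ (mul_mem hb.1 hd), hb.2 _ hd]⟩
  one_mem' := ⟨one_mem D, fun d _ => by rw [one_mul]⟩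
  inv_mem' {a} ha := ⟨inv_mem ha.1, fun d hd => by
    rw [← ha.2 _ (mul_mem (inv_mem ha.1) hd), mul_inv_cancel_left]⟩

theorem trRad_le (D : Subgroup (GL (Fin n) F)) : trRad D ≤ D := fun _ h => h.1

theorem conj_mem_trRad {D : Subgroup (GL (Fin n) F)} {g : GL (Fin n) F}
    (hg : ∀ d ∈ D, g * d * g⁻¹ ∈ D) (hg' : ∀ d ∈ D, g⁻¹ * d * g ∈ D) {d : GL (Fin n) F}
    (hd : d ∈ trRad D) : g * d * g⁻¹ ∈ trRad D := by
  refine ⟨hg d hd.1, fun d' hd' => ?_⟩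
  have h1 := hd.2 _ (hg' d' hd')
  have h2 : g * d * g⁻¹ * d' = g * (d * (g⁻¹ * d' * g)) * g⁻¹ := by group
  have tr (x : GL (Fin n) F) : ((g * x * g⁻¹ : GL (Fin n) F) : Matrix (Fin n) (Fin n) F).trace =
      (x : Matrix (Fin n) (Fin n) F).trace := by
    rw [Units.val_mul, Matrix.trace_mul_comm, ← Units.val_mul, inv_mul_cancel_left]
  rw [h2, tr, h1, ← tr]
  congr 2
  group

theorem isAlgebraicSubgroup_trRad {D : Subgroup (GL (Fin n) F)} (hD : IsAlgebraicSubgroup F n D) :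
    IsAlgebraicSubgroup F n (trRad D) := by
  obtain ⟨S, hS⟩ := hD
  refine ⟨S ∪ {p | ∃ d ∈ D, p = ∑ i, ∑ k, MvPolynomial.X (i, k) *
    MvPolynomial.C ((d : Matrix (Fin n) (Fin n) F) k i) -
      MvPolynomial.C (d : Matrix (Fin n) (Fin n) F).trace}, fun g => ?_⟩
  simp only [Set.mem_union, or_imp, forall_and, ← hS]
  refine and_congr_right fun _ => ⟨?_, fun h d hd => ?_⟩
  · rintro h p ⟨d, hd, rfl⟩
    have := h d hd
    rw [Units.val_mul, Matrix.trace] at this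
    simpa [sub_eq_zero, Matrix.mul_apply] using this
  · have := h _ ⟨d, hd, rfl⟩
    rw [Units.val_mul, Matrix.trace]
    simpa [sub_eq_zero, Matrix.mul_apply] using this

/-- The linear span of a matrix group, a subalgebra of the matrix algebra. -/
def groupSpan (D : Subgroup (GL (Fin n) F)) : Subalgebra F (Matrix (Fin n) (Fin n) F) :=
  Algebra.adjoin F (Units.val '' (D : Set (GL (Fin n) F)))

theorem coe_mem_groupSpan {D : Subgroup (GL (Fin n) F)} {d : GL (Fin n) F} (hd : d ∈ D) :
    (d : Matrix (Fin n) (Fin n) F) ∈ groupSpan D :=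
  Algebra.subset_adjoin ⟨d, hd, rfl⟩

theorem groupSpan_le {D : Subgroup (GL (Fin n) F)} {W : Submodule F (Matrix (Fin n) (Fin n) F)}
    (h : ∀ d ∈ D, (d : Matrix (Fin n) (Fin n) F) ∈ W) :
    ∀ y ∈ groupSpan D, y ∈ W := by
  intro y hy
  have hcl : (Submonoid.closure (Units.val '' (D : Set (GL (Fin n) F))) :
      Set (Matrix (Fin n) (Fin n) F)) ⊆ Units.val '' (D : Set (GL (Fin n) F)) := by
    change _ ≤ D.toSubmonoid.map (Units.coeHom _)
    rw [Submonoid.closure_le]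
    rfl
  have hy' : y ∈ Subalgebra.toSubmodule (groupSpan D) := hy
  rw [groupSpan, Algebra.adjoin_eq_span] at hy'
  refine Submodule.span_le.2 (fun x hx => ?_) hy'
  obtain ⟨d, hd, rfl⟩ := hcl hx
  exact h d hd

variable [CharZero F]

theorem trace_mul_eq_zero_of_mem_groupSpan {D : Subgroup (GL (Fin n) F)}
    {x : Matrix (Fin n) (Fin n) F}
    (h : ∀ d ∈ D, (x * (d : Matrix (Fin n) (Fin n) F)).trace = 0) :
    ∀ y ∈ groupSpan D, (x * y).trace = 0 :=
  groupSpan_le (W := LinearMap.ker (Matrix.traceLinearMap (Fin n) F F ∘ₗ LinearMap.mulLeft F x)) h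

theorem isNilpotent_of_trace_mul_eq_zero {D : Subgroup (GL (Fin n) F)}
    {x : Matrix (Fin n) (Fin n) F} (hx : x ∈ groupSpan D)
    (h : ∀ d ∈ D, (x * (d : Matrix (Fin n) (Fin n) F)).trace = 0) : IsNilpotent x :=
  isNilpotent_of_trace_pow_eq_zero_s13 fun k => by
    rw [pow_succ']
    exact trace_mul_eq_zero_of_mem_groupSpan h _ (pow_mem hx k)

theorem isUnipotentElt_of_mem_trRad {D : Subgroup (GL (Fin n) F)} {d : GL (Fin n) F}
    (hd : d ∈ trRad D) : IsUnipotentElt F n d := by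
  refine isNilpotent_of_trace_mul_eq_zero (D := D)
    (sub_mem (coe_mem_groupSpan hd.1) (one_mem _)) fun d' hd' => ?_
  rw [sub_mul, one_mul, Matrix.trace_sub, ← Units.val_mul, hd.2 d' hd', sub_self]

theorem trRad_eq_bot_of_isReductiveSubgroup {R : Subgroup (GL (Fin n) F)}
    (hR : IsAlgebraicSubgroup F n R) (hred : IsReductiveSubgroup F n R) : trRad R = ⊥ :=
  hred _ (isAlgebraicSubgroup_trRad hR) (trRad_le R)
    (fun _ hm _ hd => conj_mem_trRad (fun _ hx => mul_mem (mul_mem hm hx) (inv_mem hm))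
      (fun _ hx => mul_mem (mul_mem (inv_mem hm) hx) hm) hd)
    (isConnectedAlgSubgroup_of_isUnipotentElt (isAlgebraicSubgroup_trRad hR)
      fun _ => isUnipotentElt_of_mem_trRad)
    fun _ => isUnipotentElt_of_mem_trRad

theorem lieU_le_groupSpan (D : Subgroup (GL (Fin n) F)) :
    lieU D ≤ Subalgebra.toSubmodule (groupSpan D) := by
  refine Submodule.span_le.2 fun X hX => ?_
  rw [← map_eval_zero_derivative_pexp hX.1]
  refine derivative_mem fun t => ?_
  rw [map_eval_pexp hX.1]
  exact coe_mem_groupSpan (hX.2 t)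

theorem trace_gexp_mul {Y d : Matrix (Fin n) (Fin n) F} (hY : IsNilpotent Y)
    (h : ∀ k : ℕ, (Y ^ (k + 1) * d).trace = 0) :
    ((gexp Y : Matrix (Fin n) (Fin n) F) * d).trace = d.trace := by
  rcases subsingleton_or_nontrivial (Matrix (Fin n) (Fin n) F) with _ | _
  · congr 1
    exact Subsingleton.elim _ _
  · have hpos : 0 < nilpotencyClass Y := by
      refine Nat.pos_of_ne_zero fun h0 => one_ne_zero (α := Matrix (Fin n) (Fin n) F) ?_
      rw [← pow_zero Y, ← h0, pow_nilpotencyClass hY]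
    rw [coe_gexp hY, IsNilpotent.exp, Finset.sum_mul, Matrix.trace_sum,
      Finset.sum_eq_single_of_mem 0 (Finset.mem_range.2 hpos)]
    · simp
    · intro k _ hk
      obtain ⟨k, rfl⟩ := Nat.exists_eq_succ_of_ne_zero hk
      rw [smul_mul_assoc, Matrix.trace_smul, h k, smul_zero]

theorem lieU_le_brk {Γ D : Subgroup (GL (Fin n) F)} (hΓ : IsAlgebraicSubgroup F n Γ)
    (hrad : trRad Γ = ⊥) (hD : D ≤ Γ) (hn : ∀ g ∈ Γ, ∀ d ∈ D, g * d * g⁻¹ ∈ D) :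
    lieU D ≤ brk (lieU D) (lieU D) := by
  refine span_le_brk_span (Γ := Γ) rfl (fun X hX => hX.1) (lieU_bracket_mem_self D)
    (fun g hg X hX => conjHom_mem_lieU (hn g hg) hX) fun Y hY htr => ?_
  have hY' := lieU_mono hD hY
  have hspan : Y ∈ groupSpan Γ := lieU_le_groupSpan Γ hY'
  have hYn : IsNilpotent Y := isNilpotent_of_trace_mul_eq_zero hspan htr
  have hmem : gexp Y ∈ trRad Γ := by
    refine ⟨gexp_mem_of_mem_lieU hΓ hY' hYn, fun d hd => ?_⟩
    rw [Units.val_mul]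
    refine trace_gexp_mul hYn fun k => ?_
    rw [pow_succ', mul_assoc]
    exact trace_mul_eq_zero_of_mem_groupSpan htr _
      (mul_mem (pow_mem hspan k) (coe_mem_groupSpan hd))
  rw [hrad, Subgroup.mem_bot, ← gexp_zero] at hmem
  exact gexp_injective hYn IsNilpotent.zero hmem

end TraceRadical

section NGroup

set_option linter.unusedSectionVars false

variable {F : Type} [Field F] [CharZero F] {n : ℕ} {G U M : Subgroup (GL (Fin n) F)}

/-- The centralizer of the unipotent radical `U` in `G`. -/
abbrev radCentralizer (G U : Subgroup (GL (Fin n) F)) : Subgroup (GL (Fin n) F) :=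
  Subgroup.centralizer (U : Set (GL (Fin n) F)) ⊓ G

theorem conj_mem_radCentralizer (hU : ∀ g ∈ G, ∀ u ∈ U, g * u * g⁻¹ ∈ U) {g : GL (Fin n) F}
    (hg : g ∈ G) {v : GL (Fin n) F} (hv : v ∈ radCentralizer G U) :
    g * v * g⁻¹ ∈ radCentralizer G U := by
  refine Subgroup.mem_inf.2 ⟨Subgroup.mem_centralizer_iff.2 fun u hu => ?_,
    mul_mem (mul_mem hg hv.2) (inv_mem hg)⟩
  have h := Subgroup.mem_centralizer_iff.1 hv.1 _ (hU _ (inv_mem hg) u hu)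
  calc u * (g * v * g⁻¹) = g * (g⁻¹ * u * g⁻¹⁻¹ * v) * g⁻¹ := by group
    _ = g * v * g⁻¹ * u := by rw [h]; group

theorem IsUnipotentRadical.trRad_radCentralizer_le (h : IsUnipotentRadical F n G U) :
    trRad (radCentralizer G U) ≤ U := by
  obtain ⟨hG, -, -, hUn, -, -, hmax⟩ := h
  have halg := isAlgebraicSubgroup_trRad
    ((isAlgebraicSubgroup_centralizer (U : Set (GL (Fin n) F))).inf hG)
  refine hmax _ halg ((trRad_le _).trans inf_le_right) (fun g hg d hd => ?_)
    (isConnectedAlgSubgroup_of_isUnipotentElt halg fun _ => isUnipotentElt_of_mem_trRad)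
    fun _ => isUnipotentElt_of_mem_trRad
  refine conj_mem_trRad (fun _ => conj_mem_radCentralizer hUn hg) (fun x hx => ?_) hd
  simpa using conj_mem_radCentralizer hUn (inv_mem hg) hx

theorem commute_of_mem_radCentralizer {v u : GL (Fin n) F} (hv : v ∈ radCentralizer G U)
    (hu : u ∈ U) : Commute u v :=
  Subgroup.mem_centralizer_iff.1 hv.1 u hu

theorem trace_mul_eq_of_isUnipotentElt {a w : GL (Fin n) F} (hw : IsUnipotentElt F n w)
    (h : Commute w a) : ((a * w : GL (Fin n) F) : Matrix (Fin n) (Fin n) F).trace =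
      (a : Matrix (Fin n) (Fin n) F).trace := by
  have hc : Commute (a : Matrix (Fin n) (Fin n) F) ((w : Matrix (Fin n) (Fin n) F) - 1) :=
    (show Commute (a : Matrix (Fin n) (Fin n) F) w from
      congrArg Units.val h.symm).sub_right (Commute.one_right _)
  have h0 := trace_eq_zero_of_isNilpotent (hc.isNilpotent_mul_left hw)
  rw [mul_sub, mul_one, Matrix.trace_sub, sub_eq_zero] at h0
  rw [Units.val_mul, h0]

theorem IsNGroup.isAlgebraicSubgroup (h : IsNGroup F n G U M) : IsAlgebraicSubgroup F n M := h.2.1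

theorem IsNGroup.le (h : IsNGroup F n G U M) : M ≤ radCentralizer G U := h.2.2.1

theorem IsNGroup.eq_one {w : GL (Fin n) F} (h : IsNGroup F n G U M) (hM : w ∈ M) (hU : w ∈ U) :
    w = 1 := by
  have : w ∈ M ⊓ (radCentralizer G U ⊓ U) := ⟨hM, h.le hM, hU⟩
  rwa [h.2.2.2.1] at this

theorem IsNGroup.isUnipotentElt (h : IsNGroup F n G U M) {u : GL (Fin n) F} (hu : u ∈ U) :
    IsUnipotentElt F n u :=
  h.1.2.2.2.2.2.1 u hu

theorem IsNGroup.conj_mem (h : IsNGroup F n G U M) {g u : GL (Fin n) F} (hg : g ∈ G) (hu : u ∈ U) :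
    g * u * g⁻¹ ∈ U :=
  h.1.2.2.2.1 g hg u hu

theorem IsNGroup.exists_eq_mul (h : IsNGroup F n G U M) {v : GL (Fin n) F}
    (hv : v ∈ radCentralizer G U) :
    ∃ x ∈ M, ∃ Z, IsNilpotent Z ∧ gexp Z ∈ U ∧ v = x * gexp Z ∧
      ∀ v' ∈ radCentralizer G U, Commute (v' : Matrix (Fin n) (Fin n) F) Z := by
  obtain ⟨x, hx, w, hw, rfl⟩ := h.2.2.2.2 v hv
  obtain ⟨Z, hZ, rfl, -⟩ := exists_gexp_eq (h.isUnipotentElt hw.2)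
  exact ⟨x, hx, Z, hZ, hw.2, rfl, fun v' hv' => commute_of_commute_gexp hZ
    (congrArg Units.val (commute_of_mem_radCentralizer hv' hw.2).symm)⟩

theorem IsNGroup.trRad_eq_bot (h : IsNGroup F n G U M) : trRad M = ⊥ := by
  refine (Subgroup.eq_bot_iff_forall _).2 fun d hd => h.eq_one hd.1 ?_
  refine h.1.trRad_radCentralizer_le ⟨h.le hd.1, fun v hv => ?_⟩
  obtain ⟨x, hx, Z, hZ, hU, rfl, -⟩ := h.exists_eq_mul hv
  rw [← mul_assoc, trace_mul_eq_of_isUnipotentElt (h.isUnipotentElt hU)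
      (commute_of_mem_radCentralizer (h.le (mul_mem hd.1 hx)) hU),
    trace_mul_eq_of_isUnipotentElt (h.isUnipotentElt hU)
      (commute_of_mem_radCentralizer (h.le hx) hU), hd.2 x hx]

theorem IsNGroup.lieU_le_brk (h : IsNGroup F n G U M) {D : Subgroup (GL (Fin n) F)} (hD : D ≤ M)
    (hn : ∀ g ∈ M, ∀ d ∈ D, g * d * g⁻¹ ∈ D) : lieU D ≤ brk (lieU D) (lieU D) :=
  _root_.lieU_le_brk h.isAlgebraicSubgroup h.trRad_eq_bot hD hn

theorem IsNGroup.exists_sub_commute (h : IsNGroup F n G U M) {x : Matrix (Fin n) (Fin n) F}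
    (hx : x ∈ lieU (radCentralizer G U)) :
    ∃ y ∈ lieU M, ∀ x' ∈ lieU (radCentralizer G U), Commute (x - y) x' := by
  induction hx using Submodule.span_induction with
  | zero => exact ⟨0, zero_mem _, fun x' _ => by simp⟩
  | add a b _ _ ha hb =>
    obtain ⟨y, hy, hya⟩ := ha
    obtain ⟨z, hz, hzb⟩ := hb
    refine ⟨y + z, add_mem hy hz, fun x' hx' => ?_⟩
    rw [add_sub_add_comm]
    exact (hya x' hx').add_left (hzb x' hx')
  | smul c a _ ha =>
    obtain ⟨y, hy, hya⟩ := ha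
    refine ⟨c • y, Submodule.smul_mem _ c hy, fun x' hx' => ?_⟩
    rw [← smul_sub]
    exact (hya x' hx').smul_left c
  | mem X hX =>
    obtain ⟨hXn, hXV⟩ := hX
    have hXV1 : gexp X ∈ radCentralizer G U := by simpa using hXV 1
    obtain ⟨x, hx, Z, hZ, -, hXx, hZc⟩ := h.exists_eq_mul hXV1
    have hXZ : Commute X Z := (commute_of_commute_gexp hXn (hZc _ hXV1).symm).symm
    have hY : IsNilpotent (X - Z) := hXZ.isNilpotent_sub hXn hZ
    have hYx : gexp (X - Z) = x := by
      rw [sub_eq_add_neg, gexp_add hXn hZ.neg hXZ.neg_right, gexp_neg hZ, hXx,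
        mul_inv_cancel_right]
    refine ⟨X - Z, mem_lieU hY
      (gexp_smul_mem_of_gexp_mem h.isAlgebraicSubgroup hY (hYx.symm ▸ hx)), fun x' hx' => ?_⟩
    rw [sub_sub_cancel]
    induction hx' using Submodule.span_induction with
    | zero => simp
    | add a b _ _ ha hb => exact ha.add_right hb
    | smul c a _ ha => exact ha.smul_right c
    | mem X' hX' =>
      exact commute_of_commute_gexp hX'.1 (hZc _ (by simpa using hX'.2 1)).symm

theorem IsNGroup.brk_lieU_le (h : IsNGroup F n G U M) :
    brk (lieU (radCentralizer G U)) (lieU (radCentralizer G U)) ≤ lieU M := by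
  refine brk_le fun x₁ hx₁ x₂ hx₂ => ?_
  obtain ⟨y₁, hy₁, hc₁⟩ := h.exists_sub_commute hx₁
  obtain ⟨y₂, hy₂, hc₂⟩ := h.exists_sub_commute hx₂
  have e₁ : (x₁ - y₁) * x₂ = x₂ * (x₁ - y₁) := hc₁ x₂ hx₂
  have e₂ : (x₂ - y₂) * y₁ = y₁ * (x₂ - y₂) := hc₂ y₁ (lieU_mono h.le hy₁)
  have : x₁ * x₂ - x₂ * x₁ = y₁ * y₂ - y₂ * y₁ := by
    simp only [sub_mul, mul_sub] at e₁ e₂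
    have := congrArg₂ (· - ·) e₁ e₂
    grind
  rw [this]
  exact lieU_bracket_mem_self M y₁ hy₁ y₂ hy₂

theorem IsNGroup.mem_of_mem_brk (h : IsNGroup F n G U M) {v s : GL (Fin n) F}
    {X : Matrix (Fin n) (Fin n) F} (hv : v ∈ radCentralizer G U) (hJ : IsJordanDecomp v s X)
    (hX : X ∈ brk (lieU (radCentralizer G U)) (lieU (radCentralizer G U))) : v ∈ M := by
  have hXM : gexp X ∈ M :=
    gexp_mem_of_mem_lieU h.isAlgebraicSubgroup (h.brk_lieU_le hX) hJ.isNilpotent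
  obtain ⟨x, hx, Z, hZ, hZU, rfl, hZc⟩ := h.exists_eq_mul hv
  obtain ⟨s₂, X₂, hJ₂⟩ := exists_isJordanDecomp x
  have hX₂M : gexp X₂ ∈ M := hJ₂.gexp_mem h.isAlgebraicSubgroup hx
  have hX₂Z : Commute X₂ Z :=
    (commute_of_commute_gexp hJ₂.isNilpotent (hZc _ (h.le hX₂M)).symm).symm
  have hxs : s₂ = x * (gexp X₂)⁻¹ := eq_mul_inv_of_mul_eq hJ₂.eq_mul.symm
  have hs₂Z : Commute (s₂ : Matrix (Fin n) (Fin n) F) Z := by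
    refine hZc _ (h.le ?_)
    rw [hxs]
    exact mul_mem hx (inv_mem hX₂M)
  have hJ' : IsJordanDecomp (x * gexp Z) s₂ (X₂ + Z) :=
    ⟨hJ₂.isSemisimpleElt, hX₂Z.isNilpotent_add hJ₂.isNilpotent hZ, hJ₂.commute.add_right hs₂Z, by
      rw [gexp_add hJ₂.isNilpotent hZ hX₂Z, ← mul_assoc, ← hJ₂.eq_mul]⟩
  have hZM : gexp Z ∈ M := by
    have : gexp Z = (gexp X₂)⁻¹ * gexp X := by
      rw [(hJ.unique hJ').2, gexp_add hJ₂.isNilpotent hZ hX₂Z, inv_mul_cancel_left]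
    rw [this]
    exact mul_mem (inv_mem hX₂M) hXM
  exact mul_mem hx hZM

theorem brk_mono {A B A' B' : Submodule F (Matrix (Fin n) (Fin n) F)} (hA : A ≤ A') (hB : B ≤ B') :
    brk A B ≤ brk A' B' :=
  brk_le fun _ hx _ hy => mul_sub_mul_mem_brk (hA hx) (hB hy)

theorem IsNGroup.reductive_le (h : IsNGroup F n G U M) {R : Subgroup (GL (Fin n) F)}
    (hR : IsAlgebraicSubgroup F n R) (hRG : R ≤ G) (hn : ∀ g ∈ G, ∀ x ∈ R, g * x * g⁻¹ ∈ R)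
    (hred : IsReductiveSubgroup F n R) : R ≤ M := by
  have hconj {r x : GL (Fin n) F} (hr : r ∈ R) (hx : x ∈ R) : r * x * r⁻¹ ∈ R :=
    mul_mem (mul_mem hr hx) (inv_mem hr)
  have hRU : R ⊓ U = ⊥ := by
    have halg := hR.inf h.1.2.1
    have hunip : ∀ x ∈ R ⊓ U, IsUnipotentElt F n x := fun x hx => h.isUnipotentElt hx.2
    exact hred _ halg inf_le_left
      (fun r hr x hx => ⟨hconj hr hx.1, h.conj_mem (hRG hr) hx.2⟩)
      (isConnectedAlgSubgroup_of_isUnipotentElt halg hunip) hunip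
  have hUG : U ≤ G := h.1.2.2.1
  have hRV : R ≤ radCentralizer G U := fun r hr => by
    refine ⟨Subgroup.mem_centralizer_iff.2 fun u hu => ?_, hRG hr⟩
    have hmem : u * r * u⁻¹ * r⁻¹ ∈ R ⊓ U := by
      refine Subgroup.mem_inf.2 ⟨mul_mem (hn u (hUG hu) r hr) (inv_mem hr), ?_⟩
      have := mul_mem hu (h.conj_mem (hRG hr) (inv_mem hu))
      simpa only [mul_assoc] using this
    rw [hRU, Subgroup.mem_bot] at hmem
    exact mul_inv_eq_iff_eq_mul.1 (mul_inv_eq_one.1 hmem)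
  intro r hr
  obtain ⟨s, X, hJ⟩ := exists_isJordanDecomp r
  refine h.mem_of_mem_brk (hRV hr) hJ (brk_mono (lieU_mono hRV) (lieU_mono hRV) ?_)
  exact _root_.lieU_le_brk hR (trRad_eq_bot_of_isReductiveSubgroup hR hred) le_rfl
    (fun _ hg _ hd => hconj hg hd) (hJ.mem_lieU hR hr)

theorem IsNGroup.normal (h : IsNGroup F n G U M) {g m : GL (Fin n) F} (hg : g ∈ G) (hm : m ∈ M) :
    g * m * g⁻¹ ∈ M := by
  obtain ⟨s, X, hJ⟩ := exists_isJordanDecomp m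
  refine h.mem_of_mem_brk (conj_mem_radCentralizer (fun _ hg _ hu => h.conj_mem hg hu) hg (h.le hm))
    (hJ.conj g) ?_
  have hV : ∀ x ∈ lieU (radCentralizer G U), conjHom g x ∈ lieU (radCentralizer G U) :=
    fun x hx => conjHom_mem_lieU (fun d hd => conj_mem_radCentralizer
      (fun _ hg _ hu => h.conj_mem hg hu) hg hd) hx
  refine conjHom_mem_brk hV hV (brk_mono (lieU_mono h.le) (lieU_mono h.le) ?_)
  exact h.lieU_le_brk le_rfl (fun _ hg _ hd => mul_mem (mul_mem hg hd) (inv_mem hg))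
    (hJ.mem_lieU h.isAlgebraicSubgroup hm)

end NGroup

section Morphism

set_option linter.unusedSectionVars false

variable {F : Type} [Field F] [CharZero F] {n m : ℕ}

theorem add_mem_of_forall_gexp_mul_gexp_mem {W : Submodule F (Matrix (Fin n) (Fin n) F)}
    {A B : Matrix (Fin n) (Fin n) F} (hA : IsNilpotent A) (hB : IsNilpotent B)
    (h : ∀ t : F, ((gexp (t • A) * gexp (t • B) : GL (Fin n) F) : Matrix (Fin n) (Fin n) F) ∈ W) :
    A + B ∈ W := by
  have h0 : ∀ {X : Matrix (Fin n) (Fin n) F}, IsNilpotent X →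
      (pexp X).map (Polynomial.eval 0) = 1 := fun hX => by
    rw [map_eval_pexp hX, zero_smul, gexp_zero, Units.val_one]
  have hadd : ∀ A B : Matrix (Fin n) (Fin n) (Polynomial F), (A + B).map (Polynomial.eval 0) =
      A.map (Polynomial.eval 0) + B.map (Polynomial.eval 0) := fun A B => by ext; simp
  have := derivative_mem (W := W) (E := pexp A * pexp B) fun t => by
    rw [map_eval_mul, map_eval_pexp hA, map_eval_pexp hB]
    exact h t
  rwa [map_derivative_mul, hadd, map_eval_mul, map_eval_mul, map_eval_zero_derivative_pexp hA,
    map_eval_zero_derivative_pexp hB, h0 hA, h0 hB, mul_one, one_mul] at this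

theorem isNilpotent_of_mem_lieU {D : Subgroup (GL (Fin n) F)}
    (hu : ∀ d ∈ D, IsUnipotentElt F n d) {Y : Matrix (Fin n) (Fin n) F} (hY : Y ∈ lieU D) :
    IsNilpotent Y := by
  have htr {d : GL (Fin n) F} (hd : d ∈ D) : (d : Matrix (Fin n) (Fin n) F).trace = n := by
    have := trace_eq_zero_of_isNilpotent (hu d hd)
    rwa [Matrix.trace_sub, Matrix.trace_one, Fintype.card_fin, sub_eq_zero] at this
  refine isNilpotent_of_trace_mul_eq_zero (lieU_le_groupSpan D hY) fun d hd => ?_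
  induction hY using Submodule.span_induction with
  | zero => simp
  | add a b _ _ ha hb => rw [add_mul, Matrix.trace_add, ha, hb, add_zero]
  | smul c a _ ha => rw [smul_mul_assoc, Matrix.trace_smul, ha, smul_zero]
  | mem X hX =>
    have := apply_derivative_eq (Matrix.traceLinearMap (Fin n) F F ∘ₗ
      LinearMap.mulRight F (d : Matrix (Fin n) (Fin n) F)) (pexp X) (Polynomial.C (n : F))
      fun t => by
        rw [map_eval_pexp hX.1, Polynomial.eval_C]
        exact htr (mul_mem (hX.2 t) hd)
    rw [map_eval_zero_derivative_pexp hX.1, Polynomial.derivative_C, Polynomial.eval_zero] at this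
    exact this

variable {G U M : Subgroup (GL (Fin n) F)} {G' U' M' : Subgroup (GL (Fin m) F)}
  {f : ↥G →* GL (Fin m) F} {P : Fin m × Fin m → MvPolynomial ((Fin n × Fin n) ⊕ Unit) F}

theorem IsNGroup.le_self (hM : IsNGroup F n G U M) : M ≤ G := hM.le.trans inf_le_right

theorem IsNGroup.eq_one_of_apply_mem (hM : IsNGroup F n G U M) (hM' : IsNGroup F m G' U' M')
    (hP : IsGivenBy f P) (hrange : ∀ g : ↥G, f g ∈ G') {g : ↥G} (hg : (g : GL (Fin n) F) ∈ M)
    (hgU : f g ∈ U') : f g = 1 := by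
  obtain ⟨D, hDM, mem_D, hDf⟩ : ∃ D ≤ M, (∀ x : ↥G, (x : GL (Fin n) F) ∈ M → f x ∈ U' →
      (x : GL (Fin n) F) ∈ D) ∧ ∀ x : ↥G, (x : GL (Fin n) F) ∈ D → f x ∈ U' := by
    have mem_iff (x : ↥G) := Subgroup.mem_map_iff_mem G.subtype_injective
      (K := M.subgroupOf G ⊓ U'.comap f) (x := x)
    refine ⟨(M.subgroupOf G ⊓ U'.comap f).map G.subtype, ?_,
      fun x hx hxU => (mem_iff x).2 ⟨hx, hxU⟩, fun x hx => ((mem_iff x).1 hx).2⟩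
    rintro _ ⟨x, hx, rfl⟩
    exact hx.1
  have hDG := lieU_mono (hDM.trans hM.le_self)
  have hperf : lieU D ≤ brk (lieU D) (lieU D) := hM.lieU_le_brk hDM fun c hc d hd => by
    have hcd : c * d * c⁻¹ ∈ M := mul_mem (mul_mem hc (hDM hd)) (inv_mem hc)
    let c' : ↥G := ⟨c, hM.le_self hc⟩
    let d' : ↥G := ⟨d, hM.le_self (hDM hd)⟩
    have hf : f (c' * d' * c'⁻¹) = f c' * f d' * (f c')⁻¹ := by rw [map_mul, map_mul, map_inv]
    exact mem_D (c' * d' * c'⁻¹) hcd (hf ▸ hM'.conj_mem (hrange c') (hDf d' hd))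
  have hbr : ∀ x ∈ lieU D, ∀ y ∈ lieU D, diffAtOne P (x * y - y * x) =
      diffAtOne P x * diffAtOne P y - diffAtOne P y * diffAtOne P x :=
    fun x hx y hy => hP.diffAtOne_bracket (hDG hx) (hDG hy)
  have hq : (lieU D).map (diffAtOne P) = ⊥ := by
    refine eq_bot_of_le_brk ?_ ?_ ?_
    · rintro _ ⟨x, hx, rfl⟩ _ ⟨y, hy, rfl⟩
      rw [← hbr x hx y hy]
      exact Submodule.mem_map_of_mem (lieU_bracket_mem_self D x hx y hy)
    · have : lieU D ≤ (lieU U').comap (diffAtOne P) := by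
        refine Submodule.span_le.2 fun X hX => ?_
        obtain ⟨hn, happ⟩ := hP.isNilpotent_and_apply_gexp hX.1
          fun t => hM.le_self (hDM (hX.2 t))
        refine mem_lieU hn fun t => ?_
        rw [← happ]
        exact hDf _ (hX.2 t)
      rintro _ ⟨x, hx, rfl⟩
      exact isNilpotent_of_mem_lieU (fun _ => hM'.isUnipotentElt) (this hx)
    · rintro _ ⟨x, hx, rfl⟩
      exact map_mem_brk _ hbr (fun _ => Submodule.mem_map_of_mem)
        (fun _ => Submodule.mem_map_of_mem) (hperf hx)
  obtain ⟨s, X, hJ⟩ := exists_isJordanDecomp (g : GL (Fin n) F)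
  obtain ⟨X', hX', hexp, -⟩ := exists_gexp_eq (hM'.isUnipotentElt hgU)
  have hJ' : IsJordanDecomp (f g) 1 X' := hexp ▸ isJordanDecomp_gexp hX'
  have hXX' := hP.diffAtOne_eq hM.1.1 hJ hJ'
  have hXD : X ∈ lieU D := mem_lieU hJ.isNilpotent fun t => by
    have htM := hJ.gexp_smul_mem hM.isAlgebraicSubgroup hg t
    refine mem_D ⟨_, hM.le_self htM⟩ htM ?_
    rw [hP.apply_gexp hJ hJ' t (hM.le_self htM)]
    exact hJ'.gexp_smul_mem hM'.1.2.1 hgU t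
  have : diffAtOne P X ∈ (lieU D).map (diffAtOne P) := Submodule.mem_map_of_mem hXD
  rw [hq, Submodule.mem_bot, hXX'] at this
  rw [← hexp, this, gexp_zero]

theorem IsNGroup.commute_apply (hM : IsNGroup F n G U M) (hM' : IsNGroup F m G' U' M')
    (hP : IsGivenBy f P) (hrange : ∀ g : ↥G, f g ∈ G') {g h : ↥G} (hg : (g : GL (Fin n) F) ∈ M)
    (hU : f h ∈ U') : Commute (f g) (f h) := by
  have h1 : f (g * (h * g⁻¹ * h⁻¹)) = 1 := by
    refine hM.eq_one_of_apply_mem hM' hP hrange (mul_mem hg (hM.normal h.2 (inv_mem hg))) ?_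
    have := mul_mem (hM'.conj_mem (hrange g) hU) (inv_mem hU)
    simpa only [map_mul, map_inv, mul_assoc] using this
  simp only [map_mul, map_inv, ← mul_assoc] at h1
  exact mul_inv_eq_iff_eq_mul.1 (mul_inv_eq_one.1 h1)

theorem IsNGroup.commutator_apply_mem (hM' : IsNGroup F m G' U' M')
    (hrange : ∀ g : ↥G, f g ∈ G') (hnormal : ∀ g' ∈ G', ∀ g : ↥G, g' * f g * g'⁻¹ ∈ f.range)
    {u : GL (Fin m) F} (hu : u ∈ U') (g : ↥G) :
    ∃ h : ↥G, f h ∈ U' ∧ f g * u * (f g)⁻¹ * u⁻¹ = f h := by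
  obtain ⟨h, hh⟩ := hnormal u (hM'.1.2.2.1 hu) g⁻¹
  have hE : f g * u * (f g)⁻¹ * u⁻¹ = f (g * h) := by
    rw [map_mul, hh, map_inv]; group
  refine ⟨g * h, ?_, hE⟩
  rw [← hE]
  exact mul_mem (hM'.conj_mem (hrange g) hu) (inv_mem hu)

theorem IsNGroup.commute_sub_conjHom (hM : IsNGroup F n G U M) (hM' : IsNGroup F m G' U' M')
    (hP : IsGivenBy f P) (hrange : ∀ g : ↥G, f g ∈ G')
    (hnormal : ∀ g' ∈ G', ∀ g : ↥G, g' * f g * g'⁻¹ ∈ f.range)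
    {u : GL (Fin m) F} (hu : u ∈ U') {X Y : Matrix (Fin n) (Fin n) F}
    (hX : X ∈ lieU M) (hY : Y ∈ lieU M) :
    Commute (diffAtOne P X - conjHom u (diffAtOne P X)) (diffAtOne P Y) := by
  induction hX using Submodule.span_induction with
  | zero => simp
  | add a b _ _ ha hb =>
    rw [map_add, map_add, add_sub_add_comm]
    exact ha.add_left hb
  | smul c a _ ha =>
    rw [map_smul, map_smul, ← smul_sub]
    exact ha.smul_left c
  | mem X hX =>
    induction hY using Submodule.span_induction with
    | zero => simp
    | add a b _ _ ha hb =>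
      rw [map_add]
      exact ha.add_right hb
    | smul c a _ ha =>
      rw [map_smul]
      exact ha.smul_right c
    | mem Y hY =>
      obtain ⟨hXn, hXf⟩ := hP.isNilpotent_and_apply_gexp hX.1 fun t => hM.le_self (hX.2 t)
      obtain ⟨hYn, hYf⟩ := hP.isNilpotent_and_apply_gexp hY.1 fun t => hM.le_self (hY.2 t)
      have hc := isNilpotent_conjHom u hXn
      rw [sub_eq_add_neg]
      refine (add_mem_of_forall_gexp_mul_gexp_mem
        (W := Subalgebra.toSubmodule (Subalgebra.centralizer F {diffAtOne P Y})) hXn hc.neg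
        fun t => ?_) _ rfl |>.symm
      obtain ⟨h, hhU, hh⟩ := hM'.commutator_apply_mem hrange hnormal hu ⟨_, hM.le_self (hX.2 t)⟩
      have hcurve : gexp (t • diffAtOne P X) * gexp (t • -conjHom u (diffAtOne P X)) = f h := by
        rw [← hh, hXf, smul_neg, gexp_neg (hc.smul t),
          show t • conjHom u (diffAtOne P X) = conjHom u (t • diffAtOne P X) from
            (map_smul (conjHom u) t _).symm, gexp_conjHom u (hXn.smul t)]
        group
      have hcomm := hM.commute_apply hM' hP hrange (hY.2 1) (g := ⟨_, hM.le_self (hY.2 1)⟩) hhU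
      rw [hcurve]
      rintro _ rfl
      rw [hYf] at hcomm
      simp only [one_smul] at hcomm
      exact (commute_of_commute_gexp hYn (congrArg Units.val hcomm.symm.eq)).symm

theorem IsNGroup.conjHom_diffAtOne_eq (hM : IsNGroup F n G U M) (hM' : IsNGroup F m G' U' M')
    (hP : IsGivenBy f P) (hrange : ∀ g : ↥G, f g ∈ G')
    (hnormal : ∀ g' ∈ G', ∀ g : ↥G, g' * f g * g'⁻¹ ∈ f.range)
    {u : GL (Fin m) F} (hu : u ∈ U') {X : Matrix (Fin n) (Fin n) F} (hX : X ∈ lieU M) :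
    conjHom u (diffAtOne P X) = diffAtOne P X := by
  have hker : brk (lieU M) (lieU M) ≤
      LinearMap.ker (diffAtOne P - (conjHom u).toLinearMap ∘ₗ diffAtOne P) := by
    refine brk_le fun X hX Y hY => ?_
    rw [LinearMap.mem_ker]
    change diffAtOne P (X * Y - Y * X) - conjHom u (diffAtOne P (X * Y - Y * X)) = 0
    rw [hP.diffAtOne_bracket (lieU_mono hM.le_self hX) (lieU_mono hM.le_self hY), map_sub, map_mul,
      map_mul]
    have conj_inv (A : Matrix (Fin m) (Fin m) F) : conjHom u (conjHom u⁻¹ A) = A := by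
      rw [conjHom_apply, conjHom_apply, inv_inv, ← mul_assoc, ← mul_assoc, Units.mul_inv, one_mul,
        mul_assoc, Units.mul_inv, mul_one]
    have hXY := (hM.commute_sub_conjHom hM' hP hrange hnormal hu hX hY).eq
    have hYX := (hM.commute_sub_conjHom hM' hP hrange hnormal hu hY hX).eq
    have hXY' := congrArg (conjHom u)
      (hM.commute_sub_conjHom hM' hP hrange hnormal (inv_mem hu) hX hY).eq
    simp only [map_mul, map_sub, conj_inv] at hXY'
    simp only [sub_mul, mul_sub] at hXY hYX hXY'
    grind
  have := hker (hM.lieU_le_brk le_rfl (fun _ hg _ hd => mul_mem (mul_mem hg hd) (inv_mem hg)) hX)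
  exact (sub_eq_zero.1 this).symm

theorem IsNGroup.apply_mem_radCentralizer (hM : IsNGroup F n G U M) (hM' : IsNGroup F m G' U' M')
    (hP : IsGivenBy f P) (hrange : ∀ g : ↥G, f g ∈ G')
    (hnormal : ∀ g' ∈ G', ∀ g : ↥G, g' * f g * g'⁻¹ ∈ f.range) {g : ↥G}
    (hg : (g : GL (Fin n) F) ∈ M) : f g ∈ radCentralizer G' U' := by
  refine Subgroup.mem_inf.2 ⟨Subgroup.mem_centralizer_iff.2 fun u hu => ?_, hrange g⟩
  obtain ⟨s, X, hJ⟩ := exists_isJordanDecomp (g : GL (Fin n) F)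
  obtain ⟨s', X', hJ'⟩ := exists_isJordanDecomp (f g)
  have hX' : conjHom u X' = X' := by
    rw [← hP.diffAtOne_eq hM.1.1 hJ hJ']
    exact hM.conjHom_diffAtOne_eq hM' hP hrange hnormal hu (hJ.mem_lieU hM.isAlgebraicSubgroup hg)
  obtain ⟨h, hhU, hh⟩ := hM'.commutator_apply_mem hrange hnormal hu g
  have hc : Commute (f h)⁻¹ (f g) := (hM.commute_apply hM' hP hrange hg hhU).symm.inv_left
  obtain ⟨N, hN, hNh, -⟩ := exists_gexp_eq (hM'.isUnipotentElt (inv_mem hhU))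
  have hcN : Commute (f g) (gexp N) := hNh ▸ hc.symm
  have hsN : Commute s' (gexp N) := hNh ▸ (hJ'.commute_of_commute hc).symm
  have hNg : Commute (f g : Matrix (Fin m) (Fin m) F) N :=
    commute_of_commute_gexp hN (congrArg Units.val hcN.eq)
  have hNs : Commute (s' : Matrix (Fin m) (Fin m) F) N :=
    commute_of_commute_gexp hN (congrArg Units.val hsN.eq)
  have hNX : Commute X' N := by
    refine (commute_of_commute_gexp hJ'.isNilpotent ?_).symm
    have : gexp X' = s'⁻¹ * f g := by rw [hJ'.eq_mul, inv_mul_cancel_left]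
    rw [this, Units.val_mul]
    exact hNs.symm.units_inv_right.mul_right hNg.symm
  have hconj : u * f g * u⁻¹ = s' * gexp (X' + N) := by
    rw [gexp_add hJ'.isNilpotent hN hNX, ← mul_assoc, ← hJ'.eq_mul, hNh, ← hc.eq, ← hh]
    group
  have h1 := hJ'.conj u
  rw [hX'] at h1
  have h2 : IsJordanDecomp (u * f g * u⁻¹) s' (X' + N) :=
    ⟨hJ'.isSemisimpleElt, hNX.isNilpotent_add hJ'.isNilpotent hN, hJ'.commute.add_right hNs, hconj⟩
  have h3 : u * f g * u⁻¹ = f g := by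
    rw [hconj, ← (h1.unique h2).2, ← hJ'.eq_mul]
  exact mul_inv_eq_iff_eq_mul.1 h3

theorem IsNGroup.apply_mem (hM : IsNGroup F n G U M) (hM' : IsNGroup F m G' U' M')
    (hP : IsGivenBy f P) (hrange : ∀ g : ↥G, f g ∈ G')
    (hnormal : ∀ g' ∈ G', ∀ g : ↥G, g' * f g * g'⁻¹ ∈ f.range) {g : ↥G}
    (hg : (g : GL (Fin n) F) ∈ M) : f g ∈ M' := by
  obtain ⟨s, X, hJ⟩ := exists_isJordanDecomp (g : GL (Fin n) F)
  obtain ⟨s', X', hJ'⟩ := exists_isJordanDecomp (f g)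
  refine hM'.mem_of_mem_brk (hM.apply_mem_radCentralizer hM' hP hrange hnormal hg) hJ' ?_
  rw [← hP.diffAtOne_eq hM.1.1 hJ hJ']
  have hmap : lieU M ≤ (lieU (radCentralizer G' U')).comap (diffAtOne P) := by
    refine Submodule.span_le.2 fun X hX => ?_
    obtain ⟨hn, happ⟩ := hP.isNilpotent_and_apply_gexp hX.1 fun t => hM.le_self (hX.2 t)
    refine mem_lieU hn fun t => ?_
    rw [← happ]
    exact hM.apply_mem_radCentralizer hM' hP hrange hnormal (hX.2 t)
  refine map_mem_brk (A := lieU M) (B := lieU M) _ (fun x hx y hy => hP.diffAtOne_bracket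
    (lieU_mono hM.le_self hx) (lieU_mono hM.le_self hy))
    (fun x hx => hmap hx) (fun x hx => hmap hx) ?_
  exact hM.lieU_le_brk le_rfl (fun _ hg _ hd => mul_mem (mul_mem hg hd) (inv_mem hg))
    (hJ.mem_lieU hM.isAlgebraicSubgroup hg)

end Morphism

/-- Let `G` be a linear algebraic group over a field of characteristic `0` and
`N(G)` its maximal normal reductive subgroup.  Every normal reductive
algebraic subgroup of `G` is contained in `N(G)`; and if `f : G → G'` is a
homomorphism of algebraic groups with `f(G)` normal in `G'`, then
`f(N(G)) ⊆ N(G')`. -/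
theorem statement13 (F : Type) [Field F] [CharZero F] (n m : ℕ)
    (G U M : Subgroup (GL (Fin n) F)) (hM : IsNGroup F n G U M)
    (G' U' M' : Subgroup (GL (Fin m) F)) (hM' : IsNGroup F m G' U' M')
    (f : ↥G →* GL (Fin m) F) (hf : IsPolynomialHom F n m G f)
    (hrange : ∀ g : ↥G, f g ∈ G')
    (hnormal : ∀ g' ∈ G', ∀ g : ↥G, g' * f g * g'⁻¹ ∈ f.range) :
    (∀ R : Subgroup (GL (Fin n) F), IsAlgebraicSubgroup F n R → R ≤ G →
      (∀ g ∈ G, ∀ x ∈ R, g * x * g⁻¹ ∈ R) → IsReductiveSubgroup F n R →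
      R ≤ M) ∧
    (∀ g : ↥G, (g : GL (Fin n) F) ∈ M → f g ∈ M') := by
  obtain ⟨P, hP⟩ := hf
  have hP' : IsGivenBy f P := hP
  exact ⟨fun R hR hRG hn hred => hM.reductive_le hR hRG hn hred,
    fun g hg => hM.apply_mem hM' hP' hrange hnormal hg⟩
end
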